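/- arXiv:1302.2252 — 8 statements merged into one kernel-verified Lean document; each statement's English description precedes it below -/
import Mathlib

section
/- Let d ≥ 12 and 0 < α ≤ d/2, and let μ_α be the measure on ℝ^d with density dμ_α(x) = ‖x‖₂^{-α} dx. Then any constant K ≥ 0 satisfying the weak type (1,1) inequality λ · μ_α({x : M_{μ_α} f(x) > λ}) ≤ K · ‖f‖_{L¹(μ_α)} for all radial f ∈ L¹(μ_α) and all λ > 0 must satisfy K ≥ (1/(2e)) · (5/4)^{α/2}. -/
open MeasureTheory Metric

/-- The centered Hardy–Littlewood maximal operator associated to a Borel measure `μ` on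
`ℝ^d`, defined with closed Euclidean balls:
`M_μ f (x) = sup { (1/μ(B̄(x,r))) ∫_{B̄(x,r)} |f| dμ : r > 0, μ(B̄(x,r)) > 0 }`. -/
noncomputable def centeredMaximal {d : ℕ} (μ : Measure (EuclideanSpace ℝ (Fin d)))
    (f : EuclideanSpace ℝ (Fin d) → ℝ) (x : EuclideanSpace ℝ (Fin d)) : ENNReal :=
  ⨆ (r : ℝ) (_ : 0 < r) (_ : 0 < μ (closedBall x r)),
    (μ (closedBall x r))⁻¹ * ∫⁻ y in closedBall x r, ENNReal.ofReal |f y| ∂μ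

/-- A function on `ℝ^d` is radial if it only depends on the distance to the origin. -/
def IsRadial {d : ℕ} (f : EuclideanSpace ℝ (Fin d) → ℝ) : Prop :=
  ∃ f₀ : ℝ → ℝ, ∀ x : EuclideanSpace ℝ (Fin d), x ≠ 0 → f x = f₀ ‖x‖

/-- The measure on `ℝ^d` with density `‖x‖₂^{-α}` with respect to Lebesgue measure. -/
noncomputable def muAlpha (d : ℕ) (α : ℝ) : Measure (EuclideanSpace ℝ (Fin d)) :=
  (volume : Measure (EuclideanSpace ℝ (Fin d))).withDensity
    (fun x => ENNReal.ofReal (‖x‖ ^ (-α)))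

section MuAlpha

variable {d : ℕ} {α : ℝ}

theorem muAlpha_closedBall_smul (x : EuclideanSpace ℝ (Fin d)) (r : ℝ) {t : ℝ}
    (ht : 0 < t) :
    muAlpha d α (closedBall (t • x) (t * r)) =
      ENNReal.ofReal (t ^ (d - α)) * muAlpha d α (closedBall x r) := by
  have hmap := Measure.map_addHaar_smul (volume : Measure (EuclideanSpace ℝ (Fin d))) ht.ne'
  have hmeas : Measurable fun y : EuclideanSpace ℝ (Fin d) => ENNReal.ofReal (‖y‖ ^ (-α)) := by
    fun_prop
  set g : EuclideanSpace ℝ (Fin d) → ENNReal :=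
    (closedBall (t • x) (t * r)).indicator fun y => ENNReal.ofReal (‖y‖ ^ (-α)) with hg
  have hgm : Measurable g := hmeas.indicator measurableSet_closedBall
  have hcomp : ∀ y, g (t • y) = ENNReal.ofReal (t ^ (-α)) *
      (closedBall x r).indicator (fun y => ENNReal.ofReal (‖y‖ ^ (-α))) y := by
    intro y
    have hiff : t • y ∈ closedBall (t • x) (t * r) ↔ y ∈ closedBall x r := by
      simp only [mem_closedBall, dist_smul₀, Real.norm_of_nonneg ht.le]
      exact mul_le_mul_iff_right₀ ht
    by_cases hy : y ∈ closedBall x r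
    · rw [hg, Set.indicator_of_mem (hiff.2 hy), Set.indicator_of_mem hy, norm_smul,
        Real.norm_of_nonneg ht.le, Real.mul_rpow ht.le (norm_nonneg _),
        ENNReal.ofReal_mul (by positivity)]
    · rw [hg, Set.indicator_of_notMem (mt hiff.1 hy), Set.indicator_of_notMem hy, mul_zero]
  have hint : ∫⁻ y, g (t • y) = ENNReal.ofReal |(t ^ d)⁻¹| * ∫⁻ y, g y := by
    rw [← lintegral_map hgm (measurable_const_smul t), hmap, lintegral_smul_measure]
    simp
  simp_rw [hcomp] at hint
  rw [lintegral_const_mul _ (hmeas.indicator measurableSet_closedBall), hg,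
    lintegral_indicator measurableSet_closedBall, lintegral_indicator measurableSet_closedBall,
    ← withDensity_apply _ measurableSet_closedBall,
    ← withDensity_apply _ measurableSet_closedBall] at hint
  change _ * muAlpha d α _ = _ * muAlpha d α _ at hint
  have hd : ENNReal.ofReal (t ^ d) * ENNReal.ofReal |(t ^ d)⁻¹| = 1 := by
    rw [← ENNReal.ofReal_mul (by positivity), abs_of_pos (by positivity),
      mul_inv_cancel₀ (by positivity), ENNReal.ofReal_one]
  rw [← one_mul (muAlpha d α (closedBall (t • x) _)), ← hd, mul_assoc, ← hint, ← mul_assoc,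
    ← ENNReal.ofReal_mul (by positivity), sub_eq_add_neg, Real.rpow_add ht, Real.rpow_natCast]

theorem muAlpha_closedBall_zero {t : ℝ} (ht : 0 < t) :
    muAlpha d α (closedBall 0 t) =
      ENNReal.ofReal (t ^ (d - α)) * muAlpha d α (closedBall 0 1) := by
  simpa using muAlpha_closedBall_smul (0 : EuclideanSpace ℝ (Fin d)) 1 ht

theorem volume_le_muAlpha_unit_closedBall (hd : 0 < d) (hα : 0 ≤ α) :
    volume (closedBall (0 : EuclideanSpace ℝ (Fin d)) 1) ≤ muAlpha d α (closedBall 0 1) := by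
  have : Nonempty (Fin d) := ⟨⟨0, hd⟩⟩
  rw [muAlpha, withDensity_apply _ measurableSet_closedBall, ← setLIntegral_one]
  refine setLIntegral_mono_ae (by fun_prop) ?_
  filter_upwards [Measure.ae_ne volume (0 : EuclideanSpace ℝ (Fin d))] with y hy hy1
  rw [ENNReal.one_le_ofReal]
  exact Real.one_le_rpow_of_pos_of_le_one_of_nonpos (norm_pos_iff.2 hy)
    (by simpa using hy1) (by linarith)

theorem muAlpha_unit_closedBall_lt_top (hd : 0 < d) (hα : α < d) :
    muAlpha d α (closedBall 0 1) < ⊤ := by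
  have : Nonempty (Fin d) := ⟨⟨0, hd⟩⟩
  have h := (integrable_fun_norm_addHaar (volume : Measure (EuclideanSpace ℝ (Fin d)))
    (f := (Set.Iic (1 : ℝ)).indicator fun s => s ^ (-α))).2 <| by
    have h1 : IntegrableOn (fun s : ℝ => s ^ ((d : ℝ) - 1 - α)) (Set.Ioc 0 1) := by
      rw [← intervalIntegrable_iff_integrableOn_Ioc_of_le zero_le_one]
      exact intervalIntegral.intervalIntegrable_rpow' (by linarith)
    have h2 := (integrable_indicator_iff measurableSet_Ioc).2 h1
    refine (h2.integrableOn (s := Set.Ioi 0)).congr_fun (fun s hs => ?_) measurableSet_Ioi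
    have hs : 0 < s := hs
    by_cases hs1 : s ≤ 1
    · simp only [Set.indicator, Set.mem_Ioc, Set.mem_Iic, hs, hs1, and_self, if_true, smul_eq_mul,
        finrank_euclideanSpace, Fintype.card_fin]
      rw [sub_eq_add_neg, Real.rpow_add hs, ← Real.rpow_natCast,
        Nat.cast_sub (by omega : 1 ≤ d), Nat.cast_one]
    · simp [Set.indicator, hs1]
  have h3 : IntegrableOn (fun y : EuclideanSpace ℝ (Fin d) => ‖y‖ ^ (-α)) (closedBall 0 1) := by
    rw [← integrable_indicator_iff measurableSet_closedBall]
    refine h.congr (ae_of_all _ fun y => ?_)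
    simp [Set.indicator]
  rw [muAlpha, withDensity_apply _ measurableSet_closedBall]
  exact h3.lintegral_lt_top

theorem muAlpha_closedBall_diff_ball_le (hα : 0 ≤ α) (z : EuclideanSpace ℝ (Fin d))
    {a R : ℝ} (ha : 0 < a) (hR : 0 ≤ R) :
    muAlpha d α (closedBall z R \ ball 0 a) ≤
      ENNReal.ofReal (a ^ (-α) * R ^ d) * volume (closedBall (0 : EuclideanSpace ℝ (Fin d)) 1) := by
  have hmeas := (measurableSet_closedBall (x := z) (ε := R)).diff
    (measurableSet_ball (x := (0 : EuclideanSpace ℝ (Fin d))) (ε := a))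
  rw [muAlpha, withDensity_apply _ hmeas]
  calc ∫⁻ y in closedBall z R \ ball 0 a, ENNReal.ofReal (‖y‖ ^ (-α))
      ≤ ∫⁻ _ in closedBall z R \ ball 0 a, ENNReal.ofReal (a ^ (-α)) := by
        refine setLIntegral_mono' hmeas fun y hy => ENNReal.ofReal_le_ofReal ?_
        exact Real.rpow_le_rpow_of_nonpos ha (by simpa using hy.2) (by linarith)
    _ ≤ ENNReal.ofReal (a ^ (-α)) * volume (closedBall z R) := by
        rw [setLIntegral_const]
        gcongr
        exact Set.sdiff_subset
    _ = _ := by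
        rw [Measure.addHaar_closedBall' _ _ hR, ENNReal.ofReal_mul (by positivity), mul_assoc]
        simp

theorem norm_sub_smul_sq_le {x y : EuclideanSpace ℝ (Fin d)} {r b c : ℝ} (hx : ‖x‖ = 1)
    (hy : ‖y - x‖ ≤ r) (hb : ‖y‖ ^ 2 ≤ b) (hc0 : 0 ≤ c) (hc1 : c ≤ 1) :
    ‖y - c • x‖ ^ 2 ≤ b * (1 - c) + c * (r ^ 2 - 1) + c ^ 2 := by
  have h1 := norm_sub_sq_real y x
  have h2 := norm_sub_sq_real y (c • x)
  rw [inner_smul_right, norm_smul, hx, Real.norm_of_nonneg hc0] at h2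
  rw [hx] at h1
  have h3 : ‖y - x‖ ^ 2 ≤ r ^ 2 := pow_le_pow_left₀ (norm_nonneg _) hy 2
  rw [h2]
  nlinarith [mul_le_mul_of_nonneg_left h3 hc0, mul_le_mul_of_nonneg_right hb (sub_nonneg.2 hc1)]

theorem closedBall_subset_union {x : EuclideanSpace ℝ (Fin d)} (hx : ‖x‖ = 1) {r : ℝ}
    (hr : r ^ 2 ≤ 1 + 1 / 250) :
    closedBall x r ⊆ closedBall 0 √(4 / 5) ∪
      ((closedBall ((11 / 20 : ℝ) • x) √(4 / 5) \ ball 0 √(4 / 5)) ∪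
      ((closedBall ((5 / 8 : ℝ) • x) √(87 / 100) \ ball 0 √(11 / 10)) ∪
      (closedBall x r \ ball 0 √(5 / 4)))) := by
  intro y hy
  have hyr : ‖y - x‖ ≤ r := by simpa [dist_eq_norm] using hy
  simp only [Set.mem_union, Set.mem_sdiff, mem_closedBall, mem_ball, not_lt, dist_eq_norm,
    sub_zero, Real.sqrt_le_left, norm_nonneg]
  rcases le_total (‖y‖ ^ 2) (4 / 5) with h1 | h1
  · exact Or.inl (Real.le_sqrt_of_sq_le h1)
  right
  rcases le_total (‖y‖ ^ 2) (11 / 10) with h2 | h2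
  · refine Or.inl ⟨Real.le_sqrt_of_sq_le ?_, h1⟩
    have := norm_sub_smul_sq_le (c := 11 / 20) hx hyr h2 (by norm_num) (by norm_num)
    linarith
  right
  rcases le_total (‖y‖ ^ 2) (5 / 4) with h3 | h3
  · refine Or.inl ⟨Real.le_sqrt_of_sq_le ?_, h2⟩
    have := norm_sub_smul_sq_le (c := 5 / 8) hx hyr h3 (by norm_num) (by norm_num)
    linarith
  · exact Or.inr ⟨hyr, h3⟩

theorem sqrt_rpow_eq {a : ℝ} (ha : 0 ≤ a) (s : ℝ) : √a ^ s = a ^ (s / 2) := by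
  rw [Real.sqrt_eq_rpow, ← Real.rpow_mul ha]
  ring_nf

theorem muAlpha_closedBall_le (hd : 0 < d) (hα : 0 < α) (hαd : α ≤ d / 2)
    {x : EuclideanSpace ℝ (Fin d)} (hx : ‖x‖ = 1) {r : ℝ} (hr0 : 0 ≤ r)
    (hr : r ^ 2 ≤ 1 + 1 / 250) (hrd : r ^ d ≤ 3 / 2) :
    muAlpha d α (closedBall x r) ≤
      ENNReal.ofReal (9 / 2 * (4 / 5 : ℝ) ^ (α / 2)) * muAlpha d α (closedBall 0 1) := by
  set q : ℝ := (4 / 5 : ℝ) ^ (α / 2) with hq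
  have hq0 : 0 < q := by positivity
  have hρ : (0 : ℝ) < √(4 / 5) := by positivity
  have hv := volume_le_muAlpha_unit_closedBall hd hα.le
  have key : √(4 / 5) ^ ((d : ℝ) - α) ≤ q := by
    rw [sqrt_rpow_eq (by norm_num)]
    exact Real.rpow_le_rpow_of_exponent_ge (by norm_num) (by norm_num) (by linarith)
  have b1 : muAlpha d α (closedBall 0 √(4 / 5)) ≤
      ENNReal.ofReal q * muAlpha d α (closedBall 0 1) := by
    rw [muAlpha_closedBall_zero hρ]
    gcongr
  have b2 : muAlpha d α (closedBall ((11 / 20 : ℝ) • x) √(4 / 5) \ ball 0 √(4 / 5)) ≤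
      ENNReal.ofReal q * muAlpha d α (closedBall 0 1) := by
    refine (muAlpha_closedBall_diff_ball_le hα.le _ hρ hρ.le).trans ?_
    gcongr
    rwa [← Real.rpow_natCast, ← Real.rpow_add hρ, neg_add_eq_sub]
  have b3 : muAlpha d α (closedBall ((5 / 8 : ℝ) • x) √(87 / 100) \ ball 0 √(11 / 10)) ≤
      ENNReal.ofReal q * muAlpha d α (closedBall 0 1) := by
    refine (muAlpha_closedBall_diff_ball_le hα.le _ (by positivity) (by positivity)).trans ?_
    gcongr
    rw [← Real.rpow_natCast, sqrt_rpow_eq (by norm_num), sqrt_rpow_eq (by norm_num)]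
    calc (11 / 10 : ℝ) ^ (-α / 2) * (87 / 100) ^ ((d : ℝ) / 2)
        ≤ (11 / 10 : ℝ) ^ (-α / 2) * (87 / 100) ^ (2 * (α / 2)) := by
          gcongr ?_ * ?_
          exact Real.rpow_le_rpow_of_exponent_ge (by norm_num) (by norm_num) (by linarith)
      _ = ((11 / 10)⁻¹ * (87 / 100) ^ (2 : ℝ)) ^ (α / 2) := by
          rw [Real.mul_rpow (by norm_num) (by positivity), Real.inv_rpow (by norm_num),
            ← Real.rpow_neg (by norm_num), ← Real.rpow_mul (by norm_num), neg_div]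
      _ ≤ q := by
          refine Real.rpow_le_rpow (by positivity) ?_ (by positivity)
          norm_num
  have b4 : muAlpha d α (closedBall x r \ ball 0 √(5 / 4)) ≤
      ENNReal.ofReal (q * (3 / 2)) * muAlpha d α (closedBall 0 1) := by
    refine (muAlpha_closedBall_diff_ball_le hα.le _ (by positivity) hr0).trans ?_
    gcongr
    rw [sqrt_rpow_eq (by norm_num), neg_div, Real.rpow_neg (by norm_num),
      ← Real.inv_rpow (by norm_num), inv_div]
  calc muAlpha d α (closedBall x r)
      ≤ _ := measure_mono (closedBall_subset_union hx hr)
    _ ≤ ENNReal.ofReal q * muAlpha d α (closedBall 0 1) +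
        (ENNReal.ofReal q * muAlpha d α (closedBall 0 1) +
        (ENNReal.ofReal q * muAlpha d α (closedBall 0 1) +
        ENNReal.ofReal (q * (3 / 2)) * muAlpha d α (closedBall 0 1))) := by
        refine (measure_union_le _ _).trans (add_le_add b1 ?_)
        refine (measure_union_le _ _).trans (add_le_add b2 ?_)
        exact (measure_union_le _ _).trans (add_le_add b3 b4)
    _ = _ := by
        rw [← add_mul, ← add_mul, ← add_mul, ← ENNReal.ofReal_add (by positivity) (by positivity),
          ← ENNReal.ofReal_add (by positivity) (by positivity),
          ← ENNReal.ofReal_add (by positivity) (by positivity)]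
        congr 2
        ring

end MuAlpha

theorem isRadial_indicator_closedBall {d : ℕ} (ρ c : ℝ) :
    IsRadial ((closedBall (0 : EuclideanSpace ℝ (Fin d)) ρ).indicator fun _ => c) :=
  ⟨(Set.Iic ρ).indicator fun _ => c, fun x _ => by simp [Set.indicator]⟩

theorem le_centeredMaximal_indicator {d : ℕ} {μ : Measure (EuclideanSpace ℝ (Fin d))}
    {s : Set (EuclideanSpace ℝ (Fin d))} (hs : MeasurableSet s) {x : EuclideanSpace ℝ (Fin d)}
    {r : ℝ} (hr : 0 < r) (hsub : s ⊆ closedBall x r) (hpos : 0 < μ s) :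
    (μ (closedBall x r))⁻¹ * μ s ≤ centeredMaximal μ (s.indicator fun _ => 1) x := by
  refine le_trans ?_ (le_iSup₂_of_le r hr (le_iSup_of_le (hpos.trans_le (measure_mono hsub)) le_rfl))
  gcongr
  have : ∀ y, ENNReal.ofReal |s.indicator (fun _ => (1 : ℝ)) y| = s.indicator 1 y := by
    intro y
    by_cases hy : y ∈ s <;> simp [hy]
  simp_rw [this]
  rw [lintegral_indicator_one hs, Measure.restrict_apply hs, Set.inter_eq_left.2 hsub]

/-- Part 2) of the main theorem: for `d ≥ 12` and `0 < α ≤ d/2`, any weak type `(1,1)` constant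
for the centered maximal operator associated to `dμ_α(x) = ‖x‖₂^{-α} dx`, acting on radial
functions, is at least `(1/(2e)) (5/4)^{α/2}`. -/
theorem weak_one_one_constant_lower_bound (d : ℕ) (hd : 12 ≤ d)
    (α : ℝ) (hα : 0 < α) (hαd : α ≤ d / 2) (K : ℝ) (hK : 0 ≤ K)
    (hweak : ∀ f : EuclideanSpace ℝ (Fin d) → ℝ, IsRadial f →
      Integrable f (muAlpha d α) → ∀ lam : ℝ, 0 < lam →
        ENNReal.ofReal lam *
            (muAlpha d α) {x | ENNReal.ofReal lam < centeredMaximal (muAlpha d α) f x} ≤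
          ENNReal.ofReal K * ∫⁻ x, ENNReal.ofReal |f x| ∂(muAlpha d α)) :
    1 / (2 * Real.exp 1) * (5 / 4 : ℝ) ^ (α / 2) ≤ K := by
  have hd0 : 0 < d := by omega
  have hdR : (12 : ℝ) ≤ d := by exact_mod_cast hd
  set μ := muAlpha d α with hμ
  set q : ℝ := (4 / 5 : ℝ) ^ (α / 2) with hq
  have hq0 : 0 < q := by positivity
  set m : ℝ := (μ (closedBall 0 1)).toReal with hm
  have hfin : μ (closedBall 0 1) ≠ ⊤ :=
    (muAlpha_unit_closedBall_lt_top hd0 (by linarith)).ne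
  have hmE : μ (closedBall 0 1) = ENNReal.ofReal m := (ENNReal.ofReal_toReal hfin).symm
  have hm0 : 0 < m := ENNReal.toReal_pos
    ((measure_closedBall_pos volume _ one_pos).trans_le
      (volume_le_muAlpha_unit_closedBall hd0 hα.le)).ne' hfin
  set δ : ℝ := 1 / (1000 * d) with hδ
  have hδ0 : 0 < δ := by positivity
  have hδ1 : δ ≤ 1 / 1000 := by
    rw [hδ]
    gcongr
    linarith
  have hrd : (1 + δ) ^ d ≤ 3 / 2 := by
    calc (1 + δ) ^ d ≤ Real.exp δ ^ d := by
          gcongr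
          linarith [Real.add_one_le_exp δ]
      _ = Real.exp (1 / 1000) := by
          rw [← Real.exp_nat_mul, hδ]
          congr 1
          field_simp
      _ ≤ 1 / (1 - 1 / 1000) :=
          Real.exp_bound_div_one_sub_of_interval (by norm_num) (by norm_num)
      _ ≤ 3 / 2 := by norm_num
  set s : ℝ := (δ / 2) ^ (d - α) * m with hs
  have hs0 : 0 < s := by positivity
  set S := closedBall (0 : EuclideanSpace ℝ (Fin d)) (δ / 2) with hS
  have hSm : MeasurableSet S := measurableSet_closedBall
  have hsE : μ S = ENNReal.ofReal s := by
    rw [hS, hμ, muAlpha_closedBall_zero (by positivity), ← hμ, hmE,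
      ← ENNReal.ofReal_mul (by positivity)]
  have hint : Integrable (S.indicator fun _ => (1 : ℝ)) μ :=
    (integrable_indicator_iff hSm).2 (integrableOn_const (by simp [hsE]))
  have hnorm : ∫⁻ x, ENNReal.ofReal |S.indicator (fun _ => (1 : ℝ)) x| ∂μ = ENNReal.ofReal s := by
    rw [← hsE, ← lintegral_indicator_one hSm]
    refine lintegral_congr fun y => ?_
    by_cases hy : y ∈ S <;> simp [hy]
  set A := closedBall (0 : EuclideanSpace ℝ (Fin d)) 1 \ closedBall 0 (1 / 2) with hA
  have hhalf : μ (closedBall 0 (1 / 2)) ≤ ENNReal.ofReal (m / 64) := by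
    rw [hμ, muAlpha_closedBall_zero (by norm_num), ← hμ, hmE,
      ← ENNReal.ofReal_mul (by positivity)]
    refine ENNReal.ofReal_le_ofReal ?_
    have : (1 / 2 : ℝ) ^ ((d : ℝ) - α) ≤ (1 / 2 : ℝ) ^ ((6 : ℕ) : ℝ) :=
      Real.rpow_le_rpow_of_exponent_ge (by norm_num) (by norm_num) (by push_cast; linarith)
    rw [Real.rpow_natCast] at this
    nlinarith
  have hAm : ENNReal.ofReal (63 / 64 * m) ≤ μ A := by
    calc ENNReal.ofReal (63 / 64 * m) = ENNReal.ofReal m - ENNReal.ofReal (m / 64) := by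
          rw [← ENNReal.ofReal_sub _ (by positivity)]
          ring_nf
      _ ≤ μ (closedBall 0 1) - μ (closedBall 0 (1 / 2)) := by
          rw [hmE]
          gcongr
      _ ≤ μ A := le_measure_sdiff
  have hlarge : ∀ x ∈ A, ENNReal.ofReal (s / (5 * q * m)) <
      centeredMaximal μ (S.indicator fun _ => 1) x := by
    rintro x ⟨hx1, hx2⟩
    simp only [mem_closedBall, dist_zero_right, not_le] at hx1 hx2
    have ht0 : 0 < ‖x‖ := by linarith
    have hball : μ (closedBall x (‖x‖ * (1 + δ))) ≤ ENNReal.ofReal (9 / 2 * q * m) := by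
      have hx : ‖x‖ • (‖x‖⁻¹ • x) = x := smul_inv_smul₀ ht0.ne' x
      have hscale := muAlpha_closedBall_smul (α := α) (‖x‖⁻¹ • x) (1 + δ) ht0
      rw [hx] at hscale
      rw [hμ, hscale, ENNReal.ofReal_mul (by positivity), ← hmE]
      calc _ ≤ 1 * muAlpha d α (closedBall (‖x‖⁻¹ • x) (1 + δ)) := by
            gcongr
            rw [ENNReal.ofReal_le_one]
            exact Real.rpow_le_one ht0.le hx1 (by linarith)
        _ ≤ _ := by
            rw [one_mul]
            refine muAlpha_closedBall_le hd0 hα hαd ?_ (by positivity) (by nlinarith) hrd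
            rw [norm_smul, norm_inv, norm_norm, inv_mul_cancel₀ ht0.ne']
    have hsub : S ⊆ closedBall x (‖x‖ * (1 + δ)) := by
      intro y hy
      have hy : ‖y‖ ≤ δ / 2 := by simpa [hS] using hy
      rw [mem_closedBall, dist_eq_norm]
      nlinarith [norm_sub_le y x]
    refine lt_of_lt_of_le ?_
      (le_centeredMaximal_indicator hSm (by positivity) hsub (by simpa [hsE] using hs0))
    calc ENNReal.ofReal (s / (5 * q * m)) < ENNReal.ofReal ((9 / 2 * q * m)⁻¹ * s) := by
          rw [ENNReal.ofReal_lt_ofReal_iff (by positivity), inv_mul_eq_div]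
          gcongr
          norm_num
      _ = (ENNReal.ofReal (9 / 2 * q * m))⁻¹ * μ S := by
          rw [ENNReal.ofReal_mul (by positivity), ENNReal.ofReal_inv_of_pos (by positivity), hsE]
      _ ≤ _ := by gcongr
  have hmain := hweak _ (isRadial_indicator_closedBall (δ / 2) 1) hint (s / (5 * q * m))
    (by positivity)
  rw [hnorm, ← ENNReal.ofReal_mul hK] at hmain
  have hfinal : ENNReal.ofReal (s / (5 * q * m) * (63 / 64 * m)) ≤ ENNReal.ofReal (K * s) := by
    rw [ENNReal.ofReal_mul (by positivity)]
    refine le_trans ?_ hmain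
    gcongr
    exact hAm.trans (measure_mono hlarge)
  rw [ENNReal.ofReal_le_ofReal_iff (by positivity)] at hfinal
  have hK' : 63 / 320 * q⁻¹ ≤ K := by
    refine le_of_mul_le_mul_right (le_trans (le_of_eq ?_) hfinal) hs0
    field_simp
    norm_num
  have hqinv : (5 / 4 : ℝ) ^ (α / 2) = q⁻¹ := by
    rw [hq, ← Real.inv_rpow (by norm_num)]
    norm_num
  rw [hqinv]
  refine (mul_le_mul_of_nonneg_right ?_ (by positivity)).trans hK'
  rw [div_le_div_iff₀ (by positivity) (by norm_num)]
  linarith [Real.exp_one_gt_d9]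
end

section
/- For every α > 0 there exists a constant C = C(α) such that for every dimension d ≥ 1, every radial f ∈ L¹(ℝ^d, μ_α) and every λ > 0, one has λ · μ_α({x : M_{μ_α} f(x) > λ}) ≤ C · ‖f‖_{L¹(μ_α)}. That is, the centered maximal operator associated to the measures with density ‖x‖₂^{-α}, acting on radial functions, satisfies weak type (1,1) bounds that are uniform in the dimension. -/
open MeasureTheory Metric

open Set in
theorem exists_subset_union_of_three {X : Type*} [LinearOrder X] {A B C : Set X}
    (hA : A.OrdConnected) (hB : B.OrdConnected) (hC : C.OrdConnected) {x : X}
    (xA : x ∈ A) (xB : x ∈ B) (xC : x ∈ C) :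
    A ⊆ B ∪ C ∨ B ⊆ A ∪ C ∨ C ⊆ A ∪ B := by
  by_contra! h
  obtain ⟨h1, h2, h3⟩ := h
  obtain ⟨a, ha, ha'⟩ := not_subset.1 h1
  obtain ⟨b, hb, hb'⟩ := not_subset.1 h2
  obtain ⟨c, hc, hc'⟩ := not_subset.1 h3
  simp only [mem_union, not_or] at ha' hb' hc'
  have key : ∀ {S T : Set X} {s t : X}, S.OrdConnected → T.OrdConnected → x ∈ S → x ∈ T →
      s ∈ S → t ∈ T → s ∉ T → t ∉ S → (s < x ↔ x < t) := by
    intro S T s t hS hT xS xT sS tT sT tS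
    have n1 : s ≠ x := fun h => sT (h ▸ xT)
    have n2 : t ≠ x := fun h => tS (h ▸ xS)
    constructor
    · intro hs
      by_contra ht
      have ht : t ≤ x := not_lt.1 ht
      rcases le_total s t with h | h
      · exact tS (hS.out sS xS ⟨h, ht⟩)
      · exact sT (hT.out tT xT ⟨h, hs.le⟩)
    · intro ht
      by_contra hs
      have hs : x ≤ s := not_lt.1 hs
      rcases le_total s t with h | h
      · exact sT (hT.out xT tT ⟨hs, h⟩)
      · exact tS (hS.out xS sS ⟨ht.le, h⟩)
  have k1 := key hA hB xA xB ha hb ha'.1 hb'.1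
  have k2 := key hA hC xA xC ha hc ha'.2 hc'.1
  have k3 := key hB hC xB xC hb hc hb'.2 hc'.2
  have na : a ≠ x := fun h => ha'.1 (h ▸ xB)
  have nb : b ≠ x := fun h => hb'.1 (h ▸ xA)
  have nc : c ≠ x := fun h => hc'.1 (h ▸ xA)
  grind

open Set in
/-- A finite family of intervals has a subfamily with the same union and overlap at most two. -/
theorem exists_subfamily_overlap_le_two {X : Type*} [LinearOrder X] (s : Finset (Set X))
    (hs : ∀ I ∈ s, I.OrdConnected) :
    ∃ t ⊆ s, (⋃ I ∈ t, I) = (⋃ I ∈ s, I) ∧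
      ∀ x, ∑ I ∈ t, I.indicator (1 : X → ENNReal) x ≤ 2 := by
  classical
  obtain ⟨t, ht, hmin⟩ := (s.powerset.filter fun t => (⋃ I ∈ t, I) = (⋃ I ∈ s, I)).exists_min_image
    Finset.card ⟨s, by simp⟩
  simp only [Finset.mem_filter, Finset.mem_powerset] at ht hmin
  refine ⟨t, ht.1, ht.2, fun x => ?_⟩
  have hcard : (t.filter fun I => x ∈ I).card ≤ 2 := by
    by_contra! h
    obtain ⟨A, B, C, hA, hB, hC, hAB, hAC, hBC⟩ := Finset.two_lt_card_iff.1 h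
    simp only [Finset.mem_filter] at hA hB hC
    have key : ∀ A ∈ t, ∀ B ∈ t, ∀ C ∈ t, A ≠ B → A ≠ C → ¬ A ⊆ B ∪ C := by
      intro A hA B hB C hC hAB hAC hsub
      have := hmin (t.erase A) ⟨(t.erase_subset A).trans ht.1, by
        rw [← ht.2]
        refine Subset.antisymm (biUnion_subset_biUnion_left (t.erase_subset A)) ?_
        refine iUnion₂_subset fun I hI y hy => ?_
        simp only [mem_iUnion, Finset.mem_erase]
        by_cases hIA : I = A
        · subst hIA
          rcases hsub hy with h | h
          · exact ⟨B, ⟨hAB.symm, hB⟩, h⟩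
          · exact ⟨C, ⟨hAC.symm, hC⟩, h⟩
        · exact ⟨I, ⟨hIA, hI⟩, hy⟩⟩
      have := Finset.card_erase_lt_of_mem hA
      omega
    rcases exists_subset_union_of_three (hs _ (ht.1 hA.1)) (hs _ (ht.1 hB.1)) (hs _ (ht.1 hC.1))
      hA.2 hB.2 hC.2 with h | h | h
    · exact key A hA.1 B hB.1 C hC.1 hAB hAC h
    · exact key B hB.1 A hA.1 C hC.1 hAB.symm hBC h
    · exact key C hC.1 A hA.1 B hB.1 hAC.symm hBC.symm h
  simp only [indicator_apply, Pi.one_apply, Finset.sum_boole]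
  exact_mod_cast hcard

theorem Finset.sum_restrict_le_of_overlap {X : Type*} [MeasurableSpace X] {ρ : Measure X}
    {t : Finset (Set X)} (ht : ∀ I ∈ t, MeasurableSet I) {N : ENNReal}
    (hN : ∀ x, ∑ I ∈ t, I.indicator (1 : X → ENNReal) x ≤ N) :
    ∑ I ∈ t, ρ.restrict I ≤ N • ρ := by
  refine Measure.le_iff.2 fun A hA => ?_
  calc (∑ I ∈ t, ρ.restrict I) A = ∑ I ∈ t, ∫⁻ x in A, I.indicator 1 x ∂ρ := by
        rw [Measure.finsetSum_apply]
        refine Finset.sum_congr rfl fun I hI => ?_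
        rw [lintegral_indicator_one (ht I hI), Measure.restrict_apply hA,
          Measure.restrict_apply (ht I hI), Set.inter_comm]
    _ = ∫⁻ x in A, ∑ I ∈ t, I.indicator 1 x ∂ρ := by
        rw [lintegral_finsetSum']
        exact fun I hI => (measurable_one.indicator (ht I hI)).aemeasurable
    _ ≤ ∫⁻ x in A, N ∂ρ := lintegral_mono fun x => hN x
    _ = (N • ρ) A := by simp

/-- Weak type `(1,1)` bound for the uncentered maximal operator over intervals, for an arbitrary
outer regular measure on a linear order. -/
theorem weak_type_uncentered {X : Type*} [LinearOrder X] [TopologicalSpace X] [OrderTopology X]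
    [DenselyOrdered X] [SecondCountableTopology X] [MeasurableSpace X] [BorelSpace X] (ρ : Measure X)
    [ρ.OuterRegular] (g : X → ENNReal) (L : ENNReal) (hL : L ≠ 0) (hL' : L ≠ ⊤)
    (G : Set X)
    (hG : ∀ x ∈ G, ∃ J : Set X, J.OrdConnected ∧ x ∈ J ∧ L * ρ J < ∫⁻ y in J, g y ∂ρ) :
    L * ρ G ≤ 2 * ∫⁻ y, g y ∂ρ := by
  have hG' : ∀ x : G, ∃ U : Set X, IsOpen U ∧ U.OrdConnected ∧ ↑x ∈ U ∧
      L * ρ U ≤ ∫⁻ y in U, g y ∂ρ := by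
    rintro ⟨x, hx⟩
    obtain ⟨J, hJ, hxJ, hlt⟩ := hG x hx
    obtain ⟨V, hJV, hV, hVlt⟩ := J.exists_isOpen_lt_of_lt ((∫⁻ y in J, g y ∂ρ) / L) (μ := ρ) <| by
      rwa [ENNReal.lt_div_iff_mul_lt (Or.inl hL) (Or.inl hL'), mul_comm]
    rw [ENNReal.lt_div_iff_mul_lt (Or.inl hL) (Or.inl hL'), mul_comm] at hVlt
    have hJU : J ⊆ V.ordConnectedComponent x := fun y hy =>
      (hJ.uIcc_subset hxJ hy).trans hJV
    refine ⟨V.ordConnectedComponent x, ?_, inferInstance, hJU hxJ, ?_⟩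
    · refine isOpen_iff_mem_nhds.2 fun y hy => ?_
      rw [Set.ordConnectedComponent_eq hy]
      exact Set.ordConnectedComponent_mem_nhds.2
        (hV.mem_nhds (Set.ordConnectedComponent_subset hy))
    · calc L * ρ (V.ordConnectedComponent x) ≤ L * ρ V := by
            gcongr; exact Set.ordConnectedComponent_subset
        _ ≤ ∫⁻ y in J, g y ∂ρ := hVlt.le
        _ ≤ _ := lintegral_mono_set hJU
  choose U hUo hUc hxU hUle using hG'
  obtain ⟨T, hT, hTU⟩ := TopologicalSpace.isOpen_iUnion_countable U hUo
  have hfin : ∀ F : Finset G, L * ρ (⋃ x ∈ F, U x) ≤ 2 * ∫⁻ y, g y ∂ρ := by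
    classical
    intro F
    obtain ⟨t, hts, htU, ht2⟩ := exists_subfamily_overlap_le_two (F.image U) (by
      simp only [Finset.mem_image]; rintro _ ⟨x, _, rfl⟩; exact hUc x)
    have hmem : ∀ I ∈ t, ∃ x, U x = I := fun I hI => by
      obtain ⟨x, _, h⟩ := Finset.mem_image.1 (hts hI); exact ⟨x, h⟩
    have htm : ∀ I ∈ t, MeasurableSet I := fun I hI => by
      obtain ⟨x, rfl⟩ := hmem I hI; exact (hUo x).measurableSet
    rw [Finset.set_biUnion_finset_image] at htU
    rw [← htU]
    calc L * ρ (⋃ I ∈ t, I) ≤ L * ∑ I ∈ t, ρ I := by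
          gcongr; exact measure_biUnion_finset_le t id
      _ = ∑ I ∈ t, L * ρ I := Finset.mul_sum ..
      _ ≤ ∑ I ∈ t, ∫⁻ y in I, g y ∂ρ := Finset.sum_le_sum fun I hI => by
          obtain ⟨x, rfl⟩ := hmem I hI; exact hUle x
      _ = ∫⁻ y, g y ∂(∑ I ∈ t, ρ.restrict I) := (lintegral_finsetSum_measure ..).symm
      _ ≤ ∫⁻ y, g y ∂((2 : ENNReal) • ρ) :=
          lintegral_mono' (Finset.sum_restrict_le_of_overlap htm ht2) le_rfl
      _ = _ := by rw [lintegral_smul_measure, smul_eq_mul]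
  have hsub : G ⊆ ⋃ x ∈ T, U x := fun x hx => by
    rw [hTU]; exact Set.mem_iUnion.2 ⟨⟨x, hx⟩, hxU _⟩
  calc L * ρ G ≤ L * ρ (⋃ x ∈ T, U x) := by gcongr
    _ ≤ _ := by
      have : Countable T := hT.to_subtype
      have hmono : Monotone fun F : Finset T => ⋃ x ∈ F, U x :=
        fun F F' h => Set.biUnion_subset_biUnion_left h
      rw [Set.biUnion_eq_iUnion, Set.iUnion_eq_iUnion_finset, hmono.directed_le.measure_iUnion,
        ENNReal.mul_iSup]
      refine iSup_le fun F => le_trans ?_ (hfin (F.map (Function.Embedding.subtype _)))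
      simp

theorem weak_type_besicovitch {E : Type*} [MetricSpace E] [SecondCountableTopology E]
    [MeasurableSpace E] [OpensMeasurableSpace E] [HasBesicovitchCovering E] :
    ∃ N : ℕ, ∀ (μ : Measure E) (f : E → ENNReal) (L : ENNReal) (G : Set E),
      (∀ x ∈ G, ∃ r > 0, L * μ (closedBall x r) ≤ ∫⁻ y in closedBall x r, f y ∂μ) →
      L * μ G ≤ N * ∫⁻ y, f y ∂μ := by
  obtain ⟨N, τ, hτ, hN⟩ := HasBesicovitchCovering.no_satelliteConfig (α := E)
  refine ⟨N, fun μ f L G hG => ?_⟩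
  have hG' : ∀ x : G, ∃ r > 0, L * μ (closedBall x r) ≤ ∫⁻ y in closedBall (x : E) r, f y ∂μ :=
    fun x => hG x x.2
  choose r hr hle using hG'
  have bound : ∀ n : ℕ, L * μ {x | ∃ h : x ∈ G, r ⟨x, h⟩ ≤ n} ≤ N * ∫⁻ y, f y ∂μ := by
    intro n
    let q : Besicovitch.BallPackage {x : G // r x ≤ n} E :=
      ⟨fun x => x, fun x => r x, fun x => hr x, n, fun x => x.2⟩
    obtain ⟨s, hs, hcov⟩ := Besicovitch.exist_disjoint_covering_families hτ hN q
    have hcount : ∀ i, (s i).Countable := fun i =>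
      (hs i).countable_of_nonempty_interior fun j _ =>
        (nonempty_ball.2 (q.rpos j)).mono ball_subset_interior_closedBall
    have hsub : {x | ∃ h : x ∈ G, r ⟨x, h⟩ ≤ n} ⊆
        ⋃ i : Fin N, ⋃ j ∈ s i, closedBall (q.c j) (q.r j) := by
      rintro x ⟨hx, hxr⟩
      have := hcov ⟨⟨⟨x, hx⟩, hxr⟩, rfl⟩
      simp only [Set.mem_iUnion] at this ⊢
      obtain ⟨i, j, hj, h⟩ := this
      exact ⟨i, j, hj, ball_subset_closedBall h⟩
    calc L * μ {x | ∃ h : x ∈ G, r ⟨x, h⟩ ≤ n}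
        ≤ L * ∑ i : Fin N, ∑' j : s i, μ (closedBall (q.c j) (q.r j)) := by
          gcongr
          refine (measure_mono hsub).trans ((measure_iUnion_fintype_le _ _).trans ?_)
          exact Finset.sum_le_sum fun i _ => measure_biUnion_le _ (hcount i) _
      _ = ∑ i : Fin N, ∑' j : s i, L * μ (closedBall (q.c j) (q.r j)) := by
          simp_rw [Finset.mul_sum, ENNReal.tsum_mul_left]
      _ ≤ ∑ i : Fin N, ∫⁻ y, f y ∂μ := by
          refine Finset.sum_le_sum fun i _ => ?_
          calc ∑' j : s i, L * μ (closedBall (q.c j) (q.r j))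
              ≤ ∑' j : s i, ∫⁻ y in closedBall (q.c j) (q.r j), f y ∂μ :=
                ENNReal.tsum_le_tsum fun j => hle j.1.1
            _ = ∫⁻ y in ⋃ j ∈ s i, closedBall (q.c j) (q.r j), f y ∂μ :=
                (lintegral_biUnion (hcount i) (fun _ _ => isClosed_closedBall.measurableSet)
                  (hs i) f).symm
            _ ≤ _ := setLIntegral_le_lintegral _ _
      _ = N * ∫⁻ y, f y ∂μ := by simp
  have hmono : Monotone fun n : ℕ => {x | ∃ h : x ∈ G, r ⟨x, h⟩ ≤ n} := by
    rintro m n hmn x ⟨h, hx⟩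
    exact ⟨h, hx.trans (by exact_mod_cast hmn)⟩
  have hGU : G = ⋃ n : ℕ, {x | ∃ h : x ∈ G, r ⟨x, h⟩ ≤ n} := by
    ext x
    simp only [Set.mem_iUnion, Set.mem_ofPred_eq]
    exact ⟨fun h => (exists_nat_ge (r ⟨x, h⟩)).imp fun n hn => ⟨h, hn⟩, fun ⟨_, h, _⟩ => h⟩
  rw [hGU, hmono.measure_iUnion, ENNReal.mul_iSup]
  exact iSup_le bound

section Polar

/-- The radial part of `muAlpha d α` in polar coordinates: `t ^ (d - 1 - α) dt` on `(0, ∞)`. -/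
noncomputable def radialMeasure (d : ℕ) (α : ℝ) : Measure (Set.Ioi (0 : ℝ)) :=
  (Measure.volumeIoiPow (d - 1)).withDensity fun t => ENNReal.ofReal ((t : ℝ) ^ (-α))

/-- Polar coordinates, as a map into the ambient space. -/
noncomputable def polar (d : ℕ) (p : sphere (0 : EuclideanSpace ℝ (Fin d)) 1 × Set.Ioi (0 : ℝ)) :
    EuclideanSpace ℝ (Fin d) :=
  (p.2 : ℝ) • (p.1 : EuclideanSpace ℝ (Fin d))

theorem norm_polar {d : ℕ} (p : sphere (0 : EuclideanSpace ℝ (Fin d)) 1 × Set.Ioi (0 : ℝ)) :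
    ‖polar d p‖ = p.2 := by
  have : (0 : ℝ) < p.2 := p.2.2
  simp [polar, norm_smul, abs_of_pos this]

theorem polar_eq (d : ℕ) :
    polar d = Subtype.val ∘ (homeomorphUnitSphereProd (EuclideanSpace ℝ (Fin d))).symm := by
  ext1 p; simp [polar]

theorem measurableEmbedding_polar (d : ℕ) : MeasurableEmbedding (polar d) := by
  rw [polar_eq]
  exact (MeasurableEmbedding.subtype_coe (measurableSet_singleton _).compl).comp
    (Homeomorph.measurableEmbedding _)

theorem measurable_rpow_neg (α : ℝ) :
    Measurable fun t : Set.Ioi (0 : ℝ) => ENNReal.ofReal ((t : ℝ) ^ (-α)) := by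
  fun_prop

instance (d : ℕ) (α : ℝ) : SigmaFinite (radialMeasure d α) :=
  SigmaFinite.withDensity_ofReal _

theorem continuous_rpow_neg (α : ℝ) : Continuous fun t : Set.Ioi (0 : ℝ) => (t : ℝ) ^ (-α) :=
  continuous_subtype_val.rpow_const fun t => Or.inl (ne_of_gt t.2)

instance (n : ℕ) : IsLocallyFiniteMeasure (Measure.volumeIoiPow n) := by
  refine ⟨fun x => ?_⟩
  obtain ⟨y, hy⟩ := exists_gt x
  exact ⟨Set.Iio y, Iio_mem_nhds hy, by simp [Measure.volumeIoiPow_apply_Iio]⟩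

instance (d : ℕ) (α : ℝ) : IsLocallyFiniteMeasure (radialMeasure d α) :=
  IsLocallyFiniteMeasure.withDensity_ofReal (continuous_rpow_neg α)

theorem map_polar_volume {d : ℕ} (hd : 1 ≤ d) :
    ((volume : Measure (EuclideanSpace ℝ (Fin d))).toSphere.prod
      (Measure.volumeIoiPow (d - 1))).map (polar d) = volume := by
  have : Nonempty (Fin d) := ⟨⟨0, hd⟩⟩
  have h := (volume : Measure (EuclideanSpace ℝ (Fin d))).measurePreserving_homeomorphUnitSphereProd
  rw [finrank_euclideanSpace_fin] at h
  have h' := MeasurePreserving.symm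
    (homeomorphUnitSphereProd (EuclideanSpace ℝ (Fin d))).toMeasurableEquiv h
  have h2 := h'.map_eq
  rw [polar_eq, ← Measure.map_map measurable_subtype_coe
    (homeomorphUnitSphereProd (EuclideanSpace ℝ (Fin d))).symm.measurable]
  have h3 : Measure.map (homeomorphUnitSphereProd (EuclideanSpace ℝ (Fin d))).symm
    (volume.toSphere.prod (Measure.volumeIoiPow (d - 1))) = _ := h2
  rw [h3, (MeasurableEmbedding.subtype_coe (measurableSet_singleton _).compl).map_comap,
    Subtype.range_coe, restrict_compl_singleton]

theorem map_polar_muAlpha {d : ℕ} (hd : 1 ≤ d) (α : ℝ) :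
    ((volume : Measure (EuclideanSpace ℝ (Fin d))).toSphere.prod
      (radialMeasure d α)).map (polar d) = muAlpha d α := by
  have hm := (measurableEmbedding_polar d).measurable
  ext A hA
  rw [radialMeasure, prod_withDensity_right (measurable_rpow_neg α), Measure.map_apply hm hA,
    withDensity_apply _ (hm hA), muAlpha, withDensity_apply _ hA]
  conv_rhs => rw [← map_polar_volume hd]
  rw [(measurableEmbedding_polar d).restrict_map, (measurableEmbedding_polar d).lintegral_map]
  simp_rw [norm_polar]

theorem muAlpha_apply {d : ℕ} (hd : 1 ≤ d) (α : ℝ) (A : Set (EuclideanSpace ℝ (Fin d))) :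
    muAlpha d α A = ((volume : Measure (EuclideanSpace ℝ (Fin d))).toSphere.prod
      (radialMeasure d α)) (polar d ⁻¹' A) := by
  rw [← map_polar_muAlpha hd, (measurableEmbedding_polar d).map_apply]

theorem radialMeasure_Iio_le {d : ℕ} (hd : 1 ≤ d) {α : ℝ} (hα : 0 < α) (hdα : 2 * α ≤ d)
    (s : Set.Ioi (0 : ℝ)) :
    radialMeasure d α (Set.Iio s) ≤
      ENNReal.ofReal (2 * (s : ℝ) ^ (-α)) * Measure.volumeIoiPow (d - 1) (Set.Iio s) := by
  obtain ⟨n, rfl⟩ : ∃ n, d = n + 1 := ⟨d - 1, by omega⟩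
  obtain ⟨s, hs : 0 < s⟩ := s
  push_cast at hdα
  have hn : -1 < (n : ℝ) - α := by nlinarith [(Nat.cast_nonneg n : (0 : ℝ) ≤ n)]
  have key : radialMeasure (n + 1) α (Set.Iio ⟨s, hs⟩) =
      ENNReal.ofReal (s ^ ((n : ℝ) - α + 1) / ((n : ℝ) - α + 1)) := by
    rw [radialMeasure, Measure.volumeIoiPow, withDensity_apply _ measurableSet_Iio,
      setLIntegral_withDensity_eq_setLIntegral_mul _ (by fun_prop) (measurable_rpow_neg α)
        measurableSet_Iio]
    have : ∀ t : Set.Ioi (0 : ℝ), ((fun r : Set.Ioi (0 : ℝ) => ENNReal.ofReal ((r : ℝ) ^ (n + 1 - 1))) *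
        fun t : Set.Ioi (0 : ℝ) => ENNReal.ofReal ((t : ℝ) ^ (-α))) t
        = (fun t : ℝ => ENNReal.ofReal (t ^ ((n : ℝ) - α))) t := by
      intro t
      have ht : (0 : ℝ) < t := t.2
      simp only [Pi.mul_apply, Nat.add_sub_cancel]
      rw [← ENNReal.ofReal_mul (by positivity), ← Real.rpow_natCast, ← Real.rpow_add ht,
        sub_eq_add_neg]
    simp_rw [this]
    rw [setLIntegral_subtype measurableSet_Ioi _ fun t : ℝ => ENNReal.ofReal (t ^ ((n : ℝ) - α)),
      Set.image_subtype_val_Ioi_Iio, Measure.restrict_congr_set Ioo_ae_eq_Ioc,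
      ← ofReal_integral_eq_lintegral_ofReal, ← intervalIntegral.integral_of_le hs.le,
      integral_rpow (Or.inl hn), Real.zero_rpow (by linarith), sub_zero]
    · exact (intervalIntegral.intervalIntegrable_rpow' hn).1
    · filter_upwards [ae_restrict_mem measurableSet_Ioc] with y hy
      exact Real.rpow_nonneg hy.1.le _
  rw [key, Measure.volumeIoiPow_apply_Iio, ← ENNReal.ofReal_mul (by positivity)]
  refine ENNReal.ofReal_le_ofReal ?_
  have e : s ^ ((n : ℝ) - α + 1) = s ^ (-α) * s ^ (n + 1) := by
    rw [← Real.rpow_natCast, ← Real.rpow_add hs]; congr 1; push_cast; ring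
  simp only [Nat.add_sub_cancel]
  rw [e, mul_div_assoc', div_le_div_iff₀ (by linarith) (by positivity)]
  have : 0 < s ^ (-α) * s ^ (n + 1) := by positivity
  nlinarith

theorem muAlpha_ball_zero_le {d : ℕ} (hd : 1 ≤ d) {α : ℝ} (hα : 0 < α) (hdα : 2 * α ≤ d)
    {s : ℝ} (hs : 0 < s) :
    muAlpha d α (ball 0 s) ≤ ENNReal.ofReal (2 * s ^ (-α)) *
      volume (ball (0 : EuclideanSpace ℝ (Fin d)) s) := by
  have hpre : polar d ⁻¹' (ball 0 s) = Set.univ ×ˢ Set.Iio (⟨s, hs⟩ : Set.Ioi (0 : ℝ)) := by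
    ext p
    simp [norm_polar, ← Subtype.coe_lt_coe]
  have hvol : volume (ball (0 : EuclideanSpace ℝ (Fin d)) s) =
      ((volume : Measure (EuclideanSpace ℝ (Fin d))).toSphere.prod
        (Measure.volumeIoiPow (d - 1))) (polar d ⁻¹' (ball 0 s)) := by
    rw [← (measurableEmbedding_polar d).map_apply, map_polar_volume hd]
  rw [muAlpha_apply hd, hvol, hpre, Measure.prod_prod, Measure.prod_prod, mul_left_comm]
  exact mul_le_mul_right ( radialMeasure_Iio_le hd hα hdα _) _

end Polar

section Geometry

theorem quadratic_nonpos_of_mem_Icc {a b s k c : ℝ} (hs : s ∈ Set.Icc a b)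
    (ha : a ^ 2 - 2 * a * k + c ≤ 0) (hb : b ^ 2 - 2 * b * k + c ≤ 0) :
    s ^ 2 - 2 * s * k + c ≤ 0 := by
  obtain ⟨h1, h2⟩ := hs
  rcases h1.eq_or_lt with rfl | h1
  · exact ha
  have : (b - a) * (s ^ 2 - 2 * s * k + c) ≤ 0 := by
    have e : (b - a) * (s ^ 2 - 2 * s * k + c) = (b - s) * (a ^ 2 - 2 * a * k + c) +
      (s - a) * (b ^ 2 - 2 * b * k + c) - (b - a) * ((s - a) * (b - s)) := by ring
    rw [e]
    have := mul_nonneg (sub_nonneg.2 h2) (neg_nonneg.2 ha)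
    have := mul_nonneg (sub_nonneg.2 h1.le) (neg_nonneg.2 hb)
    have := mul_nonneg (sub_nonneg.2 (h1.le.trans h2))
      (mul_nonneg (sub_nonneg.2 h1.le) (sub_nonneg.2 h2))
    linarith
  nlinarith

variable {E : Type*} [NormedAddCommGroup E]

/-- The length of the tangent segments from the origin to the sphere of center `x` and
radius `r` (zero if the origin is in the ball). -/
noncomputable def tangentLength (x : E) (r : ℝ) : ℝ := √(‖x‖ ^ 2 - min r ‖x‖ ^ 2)

theorem tangentLength_sq (x : E) {r : ℝ} (hr : 0 < r) :
    tangentLength x r ^ 2 = ‖x‖ ^ 2 - min r ‖x‖ ^ 2 := by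
  refine Real.sq_sqrt (sub_nonneg.2 ?_)
  have : 0 ≤ min r ‖x‖ := le_min hr.le (norm_nonneg x)
  gcongr
  exact min_le_right _ _

theorem tangentLength_nonneg (x : E) (r : ℝ) : 0 ≤ tangentLength x r := Real.sqrt_nonneg _

theorem tangentLength_le (x : E) {r : ℝ} (hr : 0 < r) : tangentLength x r ≤ ‖x‖ := by
  refine abs_le_of_sq_le_sq' ?_ (norm_nonneg x) |>.2
  rw [tangentLength_sq x hr]; nlinarith

theorem tangentLength_eq_zero_or (x : E) {r : ℝ} (hr : 0 < r) :
    (tangentLength x r = 0 ∧ ‖x‖ ^ 2 - r ^ 2 ≤ 0) ∨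
      tangentLength x r ^ 2 = ‖x‖ ^ 2 - r ^ 2 := by
  rcases le_total r ‖x‖ with h | h
  · right; rw [tangentLength_sq x hr, min_eq_left h]
  · left; exact ⟨by simp [tangentLength, min_eq_right h], by nlinarith [norm_nonneg x]⟩

variable [InnerProductSpace ℝ E]

/-- The part of the shell `tangentLength x r ≤ ‖y‖ ≤ ‖x‖` lying in the cone generated by
`closedBall x r`. -/
def shellCone (x : E) (r : ℝ) : Set E :=
  {y | tangentLength x r ≤ ‖y‖ ∧ ‖y‖ ≤ ‖x‖ ∧
    tangentLength x r ^ 2 * ‖y‖ ≤ tangentLength x r * inner ℝ y x}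

theorem isClosed_shellCone (x : E) (r : ℝ) : IsClosed (shellCone x r) := by
  have h1 : IsClosed {y : E | tangentLength x r ≤ ‖y‖} := isClosed_le (by fun_prop) (by fun_prop)
  have h2 : IsClosed {y : E | ‖y‖ ≤ ‖x‖} := isClosed_le (by fun_prop) (by fun_prop)
  have h3 : IsClosed {y : E | tangentLength x r ^ 2 * ‖y‖ ≤ tangentLength x r * inner ℝ y x} :=
    isClosed_le (by fun_prop) (by fun_prop)
  exact h1.inter (h2.inter h3)

theorem shellCone_subset_closedBall {x : E} (hx : x ≠ 0) {r : ℝ} (hr : 0 < r) :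
    shellCone x r ⊆ closedBall ((tangentLength x r / ‖x‖) • x) (min r ‖x‖) := by
  rintro y ⟨h1, h2, h3⟩
  have hR : 0 < ‖x‖ := norm_pos_iff.2 hx
  have hT := tangentLength_sq x hr
  have hT0 := tangentLength_nonneg x r
  have hTR := tangentLength_le x hr
  rw [mem_closedBall_iff_norm]
  refine abs_le_of_sq_le_sq' ?_ (le_min hr.le hR.le) |>.2
  rw [@norm_sub_sq_real, inner_smul_right, norm_smul, Real.norm_of_nonneg (by positivity),
    div_mul_cancel₀ _ hR.ne']
  set T := tangentLength x r
  set R := ‖x‖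
  set t := ‖y‖
  have e1 : T ^ 2 * t / R ≤ T / R * inner ℝ y x := by
    rw [div_mul_eq_mul_div]; gcongr
  have e2 : T ^ 2 / R ≤ T := by
    rw [div_le_iff₀ hR]; nlinarith
  have e3 : 0 ≤ (R - t) * (t + R - 2 * (T ^ 2 / R)) :=
    mul_nonneg (by linarith) (by linarith)
  have e4 : (R - t) * (t + R - 2 * (T ^ 2 / R)) =
      R ^ 2 - t ^ 2 - 2 * T ^ 2 + 2 * (T ^ 2 * t / R) := by
    field_simp; ring
  linarith

/-- Every ray meets `closedBall x r ∪ shellCone x r` in an interval, which reaches the sphere of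
radius `‖x‖` unless it is empty. -/
theorem ordConnected_ray {x : E} {r : ℝ} (hr : 0 < r) {θ : E} (hθ : ‖θ‖ = 1) :
    {t : Set.Ioi (0 : ℝ) | (t : ℝ) • θ ∈ closedBall x r ∪ shellCone x r}.OrdConnected ∧
    ∀ t : Set.Ioi (0 : ℝ), (t : ℝ) • θ ∈ closedBall x r ∪ shellCone x r →
      ∀ u : Set.Ioi (0 : ℝ), (u : ℝ) = ‖x‖ → (u : ℝ) • θ ∈ closedBall x r ∪ shellCone x r := by
  set T := tangentLength x r
  set R := ‖x‖
  set k := inner ℝ θ x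
  have hT0 : 0 ≤ T := tangentLength_nonneg x r
  have hTR : T ≤ R := tangentLength_le x hr
  have hT := tangentLength_eq_zero_or x hr
  have hB : ∀ t : Set.Ioi (0 : ℝ), (t : ℝ) • θ ∈ closedBall x r ↔
      (t : ℝ) ^ 2 - 2 * t * k + (R ^ 2 - r ^ 2) ≤ 0 := by
    rintro ⟨t, ht : 0 < t⟩
    rw [mem_closedBall_iff_norm, ← sq_le_sq₀ (norm_nonneg _) hr.le, @norm_sub_sq_real,
      inner_smul_left, norm_smul, hθ, Real.norm_of_nonneg ht.le]
    simp only [conj_trivial]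
    constructor <;> intro h <;> linarith
  have hS : ∀ t : Set.Ioi (0 : ℝ), (t : ℝ) • θ ∈ shellCone x r ↔
      T ≤ t ∧ (t : ℝ) ≤ R ∧ T ^ 2 ≤ T * k := by
    rintro ⟨t, ht : 0 < t⟩
    simp only [shellCone, Set.mem_ofPred_eq, inner_smul_left, norm_smul, hθ,
      Real.norm_of_nonneg ht.le, conj_trivial, mul_one]
    refine and_congr_right fun _ => and_congr_right fun _ => ?_
    rw [show tangentLength x r * (t * inner ℝ θ x) = T * k * t by ring]
    exact mul_le_mul_iff_left₀ ht
  have hk : ∀ t : Set.Ioi (0 : ℝ), (t : ℝ) • θ ∈ closedBall x r ∪ shellCone x r →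
      T ^ 2 ≤ T * k := by
    intro t ht
    rcases ht with ht | ht
    · rw [hB] at ht
      have htpos : (0 : ℝ) < t := t.2
      rcases hT with ⟨h, _⟩ | h
      · change T = 0 at h
        simp [h]
      · change T ^ 2 = _ at h
        have : T ≤ k := by
          have : (t : ℝ) * T ≤ t * k := by nlinarith [sq_nonneg (t - T)]
          exact le_of_mul_le_mul_left this htpos
        nlinarith
    · exact ((hS t).1 ht).2.2
  have hqT : T ^ 2 ≤ T * k → T ^ 2 - 2 * T * k + (R ^ 2 - r ^ 2) ≤ 0 := by
    intro h
    rcases hT with ⟨h0, h1⟩ | h1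
    · change T = 0 at h0
      simp only [h0]; linarith
    · change T ^ 2 = _ at h1
      linarith
  refine ⟨⟨fun t₁ h₁ t₂ h₂ s hs => ?_⟩, fun t ht u hu => ?_⟩
  · have hkT := hk t₁ h₁
    have hs1 : (t₁ : ℝ) ≤ s := hs.1
    have hs2 : (s : ℝ) ≤ t₂ := hs.2
    rcases lt_or_ge (s : ℝ) T with hsT | hsT
    · rcases h₁ with h₁ | h₁
      · exact Or.inl ((hB s).2 (quadratic_nonpos_of_mem_Icc ⟨hs1, hsT.le⟩ ((hB t₁).1 h₁) (hqT hkT)))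
      · exact absurd ((hS t₁).1 h₁).1 (by linarith)
    rcases le_or_gt (s : ℝ) R with hsR | hsR
    · exact Or.inr ((hS s).2 ⟨hsT, hsR, hkT⟩)
    · rcases h₂ with h₂ | h₂
      · exact Or.inl ((hB s).2 (quadratic_nonpos_of_mem_Icc ⟨hsT, hs2⟩ (hqT hkT) ((hB t₂).1 h₂)))
      · exact absurd ((hS t₂).1 h₂).2.1 (by linarith)
  · exact Or.inr ((hS u).2 ⟨hu ▸ hTR, hu.le, hk t ht⟩)

end Geometry

theorem muAlpha_closedBall_ge {d : ℕ} (hd : 1 ≤ d) {α : ℝ} (hα : 0 < α)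
    {x : EuclideanSpace ℝ (Fin d)} {s : ℝ} (hsx : s ≤ ‖x‖) :
    ENNReal.ofReal ((2 * ‖x‖) ^ (-α)) * volume (closedBall x s) ≤ muAlpha d α (closedBall x s) := by
  have : Nonempty (Fin d) := ⟨⟨0, hd⟩⟩
  rw [muAlpha, withDensity_apply _ isClosed_closedBall.measurableSet, ← setLIntegral_const]
  refine lintegral_mono_ae ?_
  have h0 : ∀ᵐ y ∂(volume : Measure (EuclideanSpace ℝ (Fin d))), y ≠ 0 := by
    simp [ae_iff]
  filter_upwards [ae_restrict_of_ae h0, ae_restrict_mem isClosed_closedBall.measurableSet]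
    with y hy0 hy
  have hy0 : 0 < ‖y‖ := norm_pos_iff.2 hy0
  refine ENNReal.ofReal_le_ofReal (Real.rpow_le_rpow_of_nonpos hy0 ?_ (by linarith))
  rw [mem_closedBall_iff_norm] at hy
  have := norm_le_norm_add_norm_sub' y x
  linarith

theorem muAlpha_closedBall_diff_le {d : ℕ} {α : ℝ} (hα : 0 < α)
    (z : EuclideanSpace ℝ (Fin d)) {s ρ : ℝ} (hρ : 0 < ρ) :
    muAlpha d α (closedBall z s \ ball 0 ρ) ≤ ENNReal.ofReal (ρ ^ (-α)) * volume (closedBall z s) := by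
  have hm : MeasurableSet (closedBall z s \ ball 0 ρ) :=
    isClosed_closedBall.measurableSet.diff isOpen_ball.measurableSet
  rw [muAlpha, withDensity_apply _ hm]
  calc ∫⁻ y in closedBall z s \ ball 0 ρ, ENNReal.ofReal (‖y‖ ^ (-α))
      ≤ ∫⁻ y in closedBall z s \ ball 0 ρ, ENNReal.ofReal (ρ ^ (-α)) := by
        refine setLIntegral_mono' hm fun y hy => ENNReal.ofReal_le_ofReal ?_
        refine Real.rpow_le_rpow_of_nonpos hρ ?_ (by linarith)
        simpa using hy.2
    _ ≤ _ := by
        rw [setLIntegral_const]; gcongr; exact Set.sdiff_subset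

theorem muAlpha_shellCone_le {d : ℕ} (hd : 1 ≤ d) {α : ℝ} (hα : 0 < α) (hdα : 2 * α ≤ d)
    {x : EuclideanSpace ℝ (Fin d)} (hx : x ≠ 0) {r : ℝ} (hr : 0 < r) :
    muAlpha d α (shellCone x r) ≤
      ENNReal.ofReal (3 * 4 ^ α) * muAlpha d α (closedBall x r) := by
  have hR : 0 < ‖x‖ := norm_pos_iff.2 hx
  have hr' : 0 < min r ‖x‖ := lt_min hr hR
  set r' := min r ‖x‖ with hr'def
  have hvol : ∀ z : EuclideanSpace ℝ (Fin d), volume (closedBall z r') = volume (closedBall x r') :=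
    fun z => by rw [Measure.addHaar_closedBall_center, Measure.addHaar_closedBall_center volume x]
  have h1 : muAlpha d α (shellCone x r \ ball 0 (‖x‖ / 2)) ≤
      ENNReal.ofReal ((‖x‖ / 2) ^ (-α)) * volume (closedBall x r') := by
    rw [← hvol ((tangentLength x r / ‖x‖) • x)]
    refine le_trans (measure_mono ?_) (muAlpha_closedBall_diff_le hα _ (by positivity))
    exact Set.sdiff_subset_sdiff_left (shellCone_subset_closedBall hx hr)
  have h2 : muAlpha d α (shellCone x r ∩ ball 0 (‖x‖ / 2)) ≤
      ENNReal.ofReal (2 * (‖x‖ / 2) ^ (-α)) * volume (closedBall x r') := by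
    rcases lt_or_ge (tangentLength x r) (‖x‖ / 2) with h | h
    · refine (measure_mono Set.inter_subset_right).trans
        ((muAlpha_ball_zero_le hd hα hdα (by positivity)).trans ?_)
      rw [← hvol 0]
      gcongr
      refine (ball_subset_closedBall.trans (closedBall_subset_closedBall ?_))
      have hT := tangentLength_sq x hr
      have := tangentLength_nonneg x r
      nlinarith
    · have : shellCone x r ∩ ball 0 (‖x‖ / 2) = ∅ := by
        refine Set.eq_empty_of_forall_notMem fun y hy => ?_
        have h3 : ‖y‖ < ‖x‖ / 2 := by simpa using hy.2
        linarith [hy.1.1]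
      simp [this]
  have h3 : 3 * (‖x‖ / 2) ^ (-α) = 3 * 4 ^ α * (2 * ‖x‖) ^ (-α) := by
    rw [show (2 * ‖x‖) = 4 * (‖x‖ / 2) by ring, Real.mul_rpow (by norm_num) (by positivity),
      Real.rpow_neg (by norm_num : (0 : ℝ) ≤ 4)]
    field_simp
  calc muAlpha d α (shellCone x r)
      ≤ muAlpha d α (shellCone x r ∩ ball 0 (‖x‖ / 2)) +
        muAlpha d α (shellCone x r \ ball 0 (‖x‖ / 2)) := measure_le_inter_add_sdiff _ _ _
    _ ≤ ENNReal.ofReal (2 * (‖x‖ / 2) ^ (-α)) * volume (closedBall x r') +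
        ENNReal.ofReal ((‖x‖ / 2) ^ (-α)) * volume (closedBall x r') := add_le_add h2 h1
    _ = ENNReal.ofReal (3 * 4 ^ α) *
        (ENNReal.ofReal ((2 * ‖x‖) ^ (-α)) * volume (closedBall x r')) := by
        rw [← add_mul, ← ENNReal.ofReal_add (by positivity) (by positivity), ← mul_assoc,
          ← ENNReal.ofReal_mul (by positivity), ← h3]
        congr 2; ring
    _ ≤ ENNReal.ofReal (3 * 4 ^ α) * muAlpha d α (closedBall x r') := by
        gcongr; exact muAlpha_closedBall_ge hd hα (min_le_right _ _)
    _ ≤ _ := by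
        gcongr; exact min_le_left _ _

/-- The maximal function of a radial function is controlled by the uncentered one-dimensional
maximal function of its profile. -/
theorem exists_ordConnected_of_average_gt {d : ℕ} (hd : 1 ≤ d) {α : ℝ} (hα : 0 < α)
    (hdα : 2 * α ≤ d) {x : EuclideanSpace ℝ (Fin d)} {r : ℝ} (hr : 0 < r)
    {F : EuclideanSpace ℝ (Fin d) → ENNReal} {g : Set.Ioi (0 : ℝ) → ENNReal}
    (hF : ∀ p, F (polar d p) = g p.2) {L : ENNReal} (t : Set.Ioi (0 : ℝ)) (htx : (t : ℝ) = ‖x‖)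
    (h : ENNReal.ofReal (1 + 3 * 4 ^ α) * L * muAlpha d α (closedBall x r) <
      ∫⁻ y in closedBall x r, F y ∂muAlpha d α) :
    ∃ J : Set (Set.Ioi (0 : ℝ)), J.OrdConnected ∧ t ∈ J ∧
      L * radialMeasure d α J < ∫⁻ u in J, g u ∂radialMeasure d α := by
  have hx : x ≠ 0 := norm_pos_iff.1 (htx ▸ t.2)
  set B := closedBall x r ∪ shellCone x r
  have hBm : MeasurableSet B :=
    isClosed_closedBall.measurableSet.union (isClosed_shellCone x r).measurableSet
  have hP := (measurableEmbedding_polar d).measurable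
  have hB : muAlpha d α B ≤ ENNReal.ofReal (1 + 3 * 4 ^ α) * muAlpha d α (closedBall x r) := by
    rw [ENNReal.ofReal_add (by norm_num) (by positivity), add_mul, ENNReal.ofReal_one, one_mul]
    exact (measure_union_le _ _).trans (add_le_add le_rfl (muAlpha_shellCone_le hd hα hdα hx hr))
  have hlt : L * muAlpha d α B < ∫⁻ y in B, F y ∂muAlpha d α :=
    calc L * muAlpha d α B
        ≤ L * (ENNReal.ofReal (1 + 3 * 4 ^ α) * muAlpha d α (closedBall x r)) := by gcongr
      _ = ENNReal.ofReal (1 + 3 * 4 ^ α) * L * muAlpha d α (closedBall x r) := by ring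
      _ < _ := h
      _ ≤ _ := lintegral_mono_set Set.subset_union_left
  let J : sphere (0 : EuclideanSpace ℝ (Fin d)) 1 → Set (Set.Ioi (0 : ℝ)) :=
    fun θ => {t | (t : ℝ) • (θ : EuclideanSpace ℝ (Fin d)) ∈ B}
  have hJm : ∀ θ, MeasurableSet (J θ) := fun θ =>
    measurable_prodMk_left (x := θ) (hP hBm)
  obtain ⟨θ, hθ⟩ : ∃ θ, L * radialMeasure d α (J θ) < ∫⁻ u in J θ, g u ∂radialMeasure d α := by
    by_contra! hcon
    refine hlt.not_ge ?_
    rw [← lintegral_indicator hBm, ← map_polar_muAlpha hd,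
      (measurableEmbedding_polar d).lintegral_map, (measurableEmbedding_polar d).map_apply,
      Measure.prod_apply (hP hBm), ← lintegral_const_mul _ (measurable_measure_prodMk_left (hP hBm))]
    refine (lintegral_prod_le _).trans (lintegral_mono fun θ => ?_)
    refine le_trans (le_of_eq ?_) (hcon θ)
    rw [← lintegral_indicator (hJm θ)]
    refine lintegral_congr fun u => ?_
    have e : polar d (θ, u) ∈ B ↔ u ∈ J θ := Iff.rfl
    by_cases hu : u ∈ J θ
    · rw [Set.indicator_of_mem (e.2 hu), Set.indicator_of_mem hu, hF]
    · rw [Set.indicator_of_notMem (mt e.1 hu), Set.indicator_of_notMem hu]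
  have hray := ordConnected_ray (x := x) hr (norm_eq_of_mem_sphere θ)
  refine ⟨J θ, hray.1, ?_, hθ⟩
  obtain ⟨u, hu⟩ : (J θ).Nonempty := by
    by_contra! hne
    simp [hne] at hθ
  exact hray.2 u hu t htx

theorem mul_lt_lintegral_of_lt_centeredMaximal {d : ℕ} {μ : Measure (EuclideanSpace ℝ (Fin d))}
    {f : EuclideanSpace ℝ (Fin d) → ℝ} {x : EuclideanSpace ℝ (Fin d)} {L : ENNReal}
    (h : L < centeredMaximal μ f x) :
    ∃ r > 0, L * μ (closedBall x r) < ∫⁻ y in closedBall x r, ENNReal.ofReal |f y| ∂μ := by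
  simp only [centeredMaximal, lt_iSup_iff] at h
  obtain ⟨r, hr, hpos, hlt⟩ := h
  refine ⟨r, hr, ?_⟩
  have htop : μ (closedBall x r) ≠ ⊤ := by
    intro htop
    simp [htop] at hlt
  rwa [← ENNReal.div_eq_inv_mul,
    ENNReal.lt_div_iff_mul_lt (Or.inl hpos.ne') (Or.inl htop)] at hlt

theorem weak_type_radial_of_two_mul_le {d : ℕ} (hd : 1 ≤ d) {α : ℝ} (hα : 0 < α)
    (hdα : 2 * α ≤ d) {f : EuclideanSpace ℝ (Fin d) → ℝ} (hf : IsRadial f)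
    {L : ENNReal} (hL : L ≠ 0) (hL' : L ≠ ⊤) :
    L * muAlpha d α {x | L < centeredMaximal (muAlpha d α) f x} ≤
      ENNReal.ofReal (2 * (1 + 3 * 4 ^ α)) * ∫⁻ x, ENNReal.ofReal |f x| ∂(muAlpha d α) := by
  obtain ⟨f₀, hf₀⟩ := hf
  set K := ENNReal.ofReal (1 + 3 * 4 ^ α) with hK
  have hK0 : K ≠ 0 := by rw [hK, ENNReal.ofReal_ne_zero_iff]; positivity
  have hK1 : K ≠ ⊤ := ENNReal.ofReal_ne_top
  set g : Set.Ioi (0 : ℝ) → ENNReal := fun t => ENNReal.ofReal |f₀ t|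
  have hF : ∀ p, ENNReal.ofReal |f (polar d p)| = g p.2 := fun p => by
    have hp : (0 : ℝ) < p.2 := p.2.2
    rw [hf₀ _ (norm_pos_iff.1 (by rwa [norm_polar])), norm_polar]
  set S := {x | L < centeredMaximal (muAlpha d α) f x}
  set ρ := radialMeasure d α
  set σ := (volume : Measure (EuclideanSpace ℝ (Fin d))).toSphere
  set G : Set (Set.Ioi (0 : ℝ)) := {t | ∃ J : Set (Set.Ioi (0 : ℝ)), J.OrdConnected ∧ t ∈ J ∧
      L / K * ρ J < ∫⁻ u in J, g u ∂ρ}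
  have hS : polar d ⁻¹' S ⊆ Set.univ ×ˢ G := by
    intro p hp
    refine ⟨Set.mem_univ _, ?_⟩
    obtain ⟨r, hr, hlt⟩ := mul_lt_lintegral_of_lt_centeredMaximal hp
    refine exists_ordConnected_of_average_gt (F := fun y => ENNReal.ofReal |f y|) hd hα hdα hr
      hF p.2 (norm_polar p).symm ?_
    rwa [ENNReal.mul_div_cancel hK0 hK1]
  have hG : L / K * ρ G ≤ 2 * ∫⁻ u, g u ∂ρ :=
    weak_type_uncentered ρ g (L / K) (ENNReal.div_ne_zero.2 ⟨hL, hK1⟩)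
      (ENNReal.div_ne_top hL' hK0) G fun t ht => ht
  have hg : σ Set.univ * ∫⁻ u, g u ∂ρ ≤ ∫⁻ x, ENNReal.ofReal |f x| ∂(muAlpha d α) := by
    rw [← map_polar_muAlpha hd, (measurableEmbedding_polar d).lintegral_map]
    simp_rw [hF]
    refine le_trans ?_ (lintegral_map_le g Prod.snd)
    rw [Measure.map_snd_prod, lintegral_smul_measure, smul_eq_mul]
  calc L * muAlpha d α S ≤ L * (σ Set.univ * ρ G) := by
        rw [muAlpha_apply hd, ← Measure.prod_prod]
        exact mul_le_mul_right (measure_mono hS) _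
    _ = K * σ Set.univ * (L / K * ρ G) := by
        conv_lhs => rw [← ENNReal.mul_div_cancel hK0 hK1 (b := L)]
        ring
    _ ≤ K * σ Set.univ * (2 * ∫⁻ u, g u ∂ρ) := mul_le_mul_right hG _
    _ = 2 * K * (σ Set.univ * ∫⁻ u, g u ∂ρ) := by ring
    _ ≤ 2 * K * ∫⁻ x, ENNReal.ofReal |f x| ∂(muAlpha d α) := mul_le_mul_right hg _
    _ = _ := by rw [ENNReal.ofReal_mul (by norm_num), ENNReal.ofReal_ofNat]

theorem exists_weak_type_centeredMaximal (d : ℕ) :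
    ∃ N : ℕ, ∀ (μ : Measure (EuclideanSpace ℝ (Fin d))) (f : EuclideanSpace ℝ (Fin d) → ℝ)
      (L : ENNReal), L * μ {x | L < centeredMaximal μ f x} ≤
        N * ∫⁻ x, ENNReal.ofReal |f x| ∂μ := by
  obtain ⟨N, hN⟩ := weak_type_besicovitch (E := EuclideanSpace ℝ (Fin d))
  refine ⟨N, fun μ f L => hN μ _ L _ fun x hx => ?_⟩
  obtain ⟨r, hr, h⟩ := mul_lt_lintegral_of_lt_centeredMaximal hx
  exact ⟨r, hr, h.le⟩

/-- Part 3) of the main theorem: for each fixed `α > 0`, the centered maximal operator associated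
to the measures `dμ_α(x) = ‖x‖₂^{-α} dx` on `ℝ^d`, acting on radial functions, satisfies weak type
`(1,1)` bounds that are uniform in the dimension `d`. -/
theorem uniform_weak_one_one_bounds (α : ℝ) (hα : 0 < α) :
    ∃ C : ℝ, ∀ d : ℕ, 1 ≤ d → ∀ f : EuclideanSpace ℝ (Fin d) → ℝ, IsRadial f →
      Integrable f (muAlpha d α) → ∀ lam : ℝ, 0 < lam →
        ENNReal.ofReal lam *
            (muAlpha d α) {x | ENNReal.ofReal lam < centeredMaximal (muAlpha d α) f x} ≤
          ENNReal.ofReal C * ∫⁻ x, ENNReal.ofReal |f x| ∂(muAlpha d α) := by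
  choose N hN using exists_weak_type_centeredMaximal
  refine ⟨2 * (1 + 3 * 4 ^ α) + ∑ k ∈ Finset.range ⌈2 * α⌉₊, (N k : ℝ),
    fun d hd f hf _ lam hlam => ?_⟩
  rcases le_or_gt (2 * α) d with h | h
  · refine (weak_type_radial_of_two_mul_le hd hα h hf (by simpa using hlam)
      ENNReal.ofReal_ne_top).trans ?_
    gcongr
    exact le_add_of_nonneg_right (by positivity)
  · refine (hN d _ f _).trans ?_
    gcongr
    rw [← ENNReal.ofReal_natCast]
    refine ENNReal.ofReal_le_ofReal ?_
    have hmem : d ∈ Finset.range ⌈2 * α⌉₊ := Finset.mem_range.2 (Nat.lt_ceil.2 h)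
    have h1 := Finset.single_le_sum (f := fun k => (N k : ℝ)) (fun k _ => by positivity) hmem
    have h2 : (0 : ℝ) ≤ 2 * (1 + 3 * 4 ^ α) := by positivity
    linarith
end

section
/- Fix 1/2 < α < 1, set R = √(1 − 4(1−α)²) and s₀ = 2√(α(1−α)), and for each d let μ_d be the measure on ℝ^d with density dμ_d(x) = ‖x‖₂^{-αd} dx. Then there exist a constant c = c(α) > 0 and d₀ ∈ ℕ such that for all d ≥ d₀, μ_d(B(e₁,R) ∩ B(0,s₀)) / μ_d(B(e₁,R)) ≥ c/√d, where e₁ is the first standard basis vector of ℝ^d. -/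
open MeasureTheory Metric

theorem lintegral_ball_norm_rpow_neg {n : ℕ} (hn : 0 < n) {p ρ : ℝ} (hp : p < n) (hρ : 0 < ρ) :
    ∫⁻ y in ball (0 : EuclideanSpace ℝ (Fin n)) ρ, ENNReal.ofReal (‖y‖ ^ (-p)) =
      ENNReal.ofReal (n / (n - p) * ρ ^ (n - p)) *
        volume (ball (0 : EuclideanSpace ℝ (Fin n)) 1) := by
  have : NeZero n := ⟨hn.ne'⟩
  have hpow : ∀ y ∈ Set.Ioo 0 ρ, y ^ (n - 1) • y ^ (-p) = y ^ ((n : ℝ) - 1 - p) := by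
    intro y hy
    rw [smul_eq_mul, ← Real.rpow_natCast, ← Real.rpow_add hy.1, Nat.cast_sub hn]
    congr 1
    push_cast
    ring
  have hinteg : IntegrableOn (fun y : EuclideanSpace ℝ (Fin n) => ‖y‖ ^ (-p)) (ball 0 ρ) := by
    rw [integrableOn_fun_norm_addHaar volume (f := fun y => y ^ (-p)), finrank_euclideanSpace_fin,
      integrableOn_congr_fun hpow measurableSet_Ioo,
      intervalIntegral.integrableOn_Ioo_rpow_iff hρ]
    linarith
  have hval : ∫ y in ball (0 : EuclideanSpace ℝ (Fin n)) ρ, ‖y‖ ^ (-p) =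
      n / (n - p) * ρ ^ (n - p) * volume.real (ball (0 : EuclideanSpace ℝ (Fin n)) 1) := by
    have hball : ∀ y : EuclideanSpace ℝ (Fin n), (ball 0 ρ).indicator (fun y => ‖y‖ ^ (-p)) y =
        (Set.Iio ρ).indicator (fun r => r ^ (-p)) ‖y‖ := by
      intro y
      simp [Set.indicator]
    rw [← integral_indicator measurableSet_ball, funext hball,
      integral_fun_norm_addHaar volume ((Set.Iio ρ).indicator (fun r => r ^ (-p))),
      finrank_euclideanSpace_fin]
    have hind : ∀ y : ℝ, y ^ (n - 1) • (Set.Iio ρ).indicator (fun r => r ^ (-p)) y =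
        (Set.Iio ρ).indicator (fun y => y ^ (n - 1) • y ^ (-p)) y := by
      intro y
      by_cases hy : y < ρ <;> simp [hy]
    simp_rw [hind]
    rw [setIntegral_indicator measurableSet_Iio, Set.Ioi_inter_Iio,
      setIntegral_congr_fun measurableSet_Ioo hpow, ← integral_Ioc_eq_integral_Ioo,
      ← intervalIntegral.integral_of_le hρ.le, integral_rpow (Or.inl (by linarith))]
    have h1 : (n : ℝ) - 1 - p + 1 = n - p := by ring
    have h2 : (n : ℝ) - p ≠ 0 := by linarith
    rw [h1, Real.zero_rpow h2, nsmul_eq_mul, smul_eq_mul]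
    ring
  rw [← ofReal_integral_eq_lintegral_ofReal hinteg
    (Filter.Eventually.of_forall fun y => by positivity), hval, ENNReal.ofReal_mul,
    ofReal_measureReal (measure_ball_lt_top (μ := volume)).ne]
  have : 0 < (n : ℝ) - p := by linarith
  positivity

/-- Integration in cylindrical coordinates around the first axis. -/
theorem lintegral_euclideanSpace_succ {n : ℕ} {F : ℝ → ℝ → ENNReal}
    (hF : Measurable (Function.uncurry F)) :
    ∫⁻ x : EuclideanSpace ℝ (Fin (n + 1)), F (x 0) (‖x‖ ^ 2) =
      ∫⁻ t : ℝ, ∫⁻ y : EuclideanSpace ℝ (Fin n), F t (t ^ 2 + ‖y‖ ^ 2) := by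
  have hmp := ((MeasurePreserving.id (volume : Measure ℝ)).prod
    (PiLp.volume_preserving_toLp (Fin n))).comp
      ((volume_preserving_piFinSuccAbove (fun _ : Fin (n + 1) => ℝ) 0).comp
        (PiLp.volume_preserving_ofLp (Fin (n + 1))))
  have hG : Measurable (fun z : ℝ × EuclideanSpace ℝ (Fin n) => F z.1 (z.1 ^ 2 + ‖z.2‖ ^ 2)) :=
    hF.comp (by fun_prop : Measurable
      fun z : ℝ × EuclideanSpace ℝ (Fin n) => (z.1, z.1 ^ 2 + ‖z.2‖ ^ 2))
  rw [← lintegral_prod _ hG.aemeasurable]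
  rw [← hmp.lintegral_comp hG]
  refine lintegral_congr fun x => ?_
  simp [EuclideanSpace.norm_sq_eq, Fin.sum_univ_succ, Fin.tail]

theorem lintegral_slice_le {n : ℕ} (hn : 0 < n) {p t w : ℝ} (hp0 : 0 ≤ p) (hp : p < n)
    (hw : t ^ 2 < w) :
    ∫⁻ y : EuclideanSpace ℝ (Fin n), (Set.Iio w).indicator
        (fun v => ENNReal.ofReal (v ^ (-p / 2))) (t ^ 2 + ‖y‖ ^ 2) ≤
      ENNReal.ofReal (n / (n - p) * (w ^ (-p / 2) * (w - t ^ 2) ^ ((n : ℝ) / 2))) *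
        volume (ball (0 : EuclideanSpace ℝ (Fin n)) 1) := by
  have : NeZero n := ⟨hn.ne'⟩
  have hw0 : 0 < w := (sq_nonneg t).trans_lt hw
  have hd : 0 < w - t ^ 2 := sub_pos.2 hw
  set ρ := √(w - t ^ 2) with hρ
  have hρ0 : 0 < ρ := Real.sqrt_pos.2 hd
  have hρ2 : ρ ^ 2 = w - t ^ 2 := Real.sq_sqrt hd.le
  calc _ ≤ ∫⁻ y : EuclideanSpace ℝ (Fin n), (ball 0 ρ).indicator
        (fun y => ENNReal.ofReal (ρ ^ p * w ^ (-p / 2)) * ENNReal.ofReal (‖y‖ ^ (-p))) y := by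
        refine lintegral_mono_ae ?_
        filter_upwards [Measure.ae_ne volume (0 : EuclideanSpace ℝ (Fin n))] with y hy
        have hy0 : 0 < ‖y‖ := norm_pos_iff.2 hy
        by_cases h : t ^ 2 + ‖y‖ ^ 2 < w
        · have hyρ : ‖y‖ < ρ := Real.lt_sqrt_of_sq_lt (by linarith)
          rw [Set.indicator_of_mem (by exact h), Set.indicator_of_mem (by simpa using hyρ),
            ← ENNReal.ofReal_mul (by positivity)]
          refine ENNReal.ofReal_le_ofReal ?_
          have hbase : (‖y‖ / ρ) ^ 2 * w ≤ t ^ 2 + ‖y‖ ^ 2 := by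
            rw [div_pow, div_mul_eq_mul_div, div_le_iff₀ (by positivity), hρ2]
            nlinarith [mul_nonneg (sq_nonneg t) (sub_pos.2 h).le]
          refine (Real.rpow_le_rpow_of_nonpos (by positivity) hbase (by linarith)).trans_eq ?_
          rw [Real.mul_rpow (by positivity) hw0.le, ← Real.rpow_natCast, ← Real.rpow_mul
            (by positivity), Real.div_rpow hy0.le hρ0.le, show ((2 : ℕ) : ℝ) * (-p / 2) = -p by
            push_cast; ring, Real.rpow_neg hρ0.le p]
          field_simp
        · rw [Set.indicator_of_notMem (by exact h)]
          exact zero_le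
    _ = _ := by
        rw [lintegral_indicator measurableSet_ball, lintegral_const_mul' _ _ ENNReal.ofReal_ne_top,
          lintegral_ball_norm_rpow_neg hn hp hρ0, ← mul_assoc, ← ENNReal.ofReal_mul
          (by positivity), ← hρ2, ← Real.rpow_natCast ρ 2, ← Real.rpow_mul hρ0.le,
          show ((2 : ℕ) : ℝ) * (n / 2) = p + (n - p) by push_cast; ring, Real.rpow_add hρ0]
        ring_nf

theorem le_lintegral_slice {n : ℕ} {p t w : ℝ} (hp0 : 0 ≤ p) (ht : t ≠ 0) (hw : t ^ 2 < w) :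
    ENNReal.ofReal (w ^ (-p / 2) * (w - t ^ 2) ^ ((n : ℝ) / 2)) *
        volume (ball (0 : EuclideanSpace ℝ (Fin n)) 1) ≤
    ∫⁻ y : EuclideanSpace ℝ (Fin n), (Set.Iio w).indicator
        (fun v => ENNReal.ofReal (v ^ (-p / 2))) (t ^ 2 + ‖y‖ ^ 2) := by
  have hw0 : 0 < w := (sq_nonneg t).trans_lt hw
  have hd : 0 < w - t ^ 2 := sub_pos.2 hw
  set ρ := √(w - t ^ 2) with hρ
  have hρ0 : 0 < ρ := Real.sqrt_pos.2 hd
  have hρ2 : ρ ^ 2 = w - t ^ 2 := Real.sq_sqrt hd.le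
  calc _ = ∫⁻ y : EuclideanSpace ℝ (Fin n), (ball 0 ρ).indicator
        (fun _ => ENNReal.ofReal (w ^ (-p / 2))) y := by
        rw [lintegral_indicator measurableSet_ball, setLIntegral_const,
          Measure.addHaar_ball_of_pos _ _ hρ0, finrank_euclideanSpace_fin, ← mul_assoc,
          ← ENNReal.ofReal_mul (by positivity), ← hρ2, ← Real.rpow_natCast ρ 2,
          ← Real.rpow_mul hρ0.le, show ((2 : ℕ) : ℝ) * (n / 2) = n by push_cast; ring,
          Real.rpow_natCast]
    _ ≤ _ := by
        refine lintegral_mono fun y => ?_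
        by_cases h : ‖y‖ < ρ
        · have h' : t ^ 2 + ‖y‖ ^ 2 < w := by
            have := pow_lt_pow_left₀ h (norm_nonneg y) two_ne_zero
            linarith
          have ht2 : 0 < t ^ 2 := by positivity
          rw [Set.indicator_of_mem (by simpa using h), Set.indicator_of_mem (by exact h')]
          exact ENNReal.ofReal_le_ofReal
            (Real.rpow_le_rpow_of_nonpos (by positivity) h'.le (by linarith))
        · rw [Set.indicator_of_notMem (by simpa using h)]
          exact zero_le

theorem exp_mul_profile_le {α : ℝ} (h₁ : 1 / 2 < α) (h₂ : α < 1) (x : ℝ) :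
    Real.exp ((1 - α) * x) * (1 - 2 * (1 - α) ^ 2 - α * (1 - α) * Real.exp x -
      (1 - α) ^ 3 / α * Real.exp (-x)) ≤ (2 * α - 1) / α := by
  have hα : 0 < α := by linarith
  have hβ : 0 < 1 - α := by linarith
  have hA : 0 < α * (1 - α) := by positivity
  have hB : 0 < (1 - α) ^ 3 / α := by positivity
  have e1 := mul_le_mul_of_nonneg_left (Real.add_one_le_exp x) hA.le
  have e2 := mul_le_mul_of_nonneg_left (Real.add_one_le_exp (-x)) hB.le
  have hid : 1 - 2 * (1 - α) ^ 2 - α * (1 - α) * (x + 1) - (1 - α) ^ 3 / α * (-x + 1) =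
      (2 * α - 1) / α * (-((1 - α) * x) + 1) := by
    field_simp
    ring
  have hQ : 0 < (2 * α - 1) / α := div_pos (by linarith) hα
  have e3 := mul_le_mul_of_nonneg_left (Real.add_one_le_exp (-((1 - α) * x))) hQ.le
  calc _ ≤ Real.exp ((1 - α) * x) * ((2 * α - 1) / α * Real.exp (-((1 - α) * x))) := by
        gcongr
        linarith
    _ = (2 * α - 1) / α := by
        rw [mul_left_comm, ← Real.exp_add]
        simp

theorem le_exp_mul_profile {α : ℝ} (h₁ : 1 / 2 < α) (h₂ : α < 1) :
    ∃ C : ℝ, 1 ≤ C ∧ ∀ x ≤ 0, C * x ^ 2 ≤ 1 →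
      (2 * α - 1) / α * (1 - C * x ^ 2) ≤
      Real.exp ((1 - α) * x) * (1 - 2 * (1 - α) ^ 2 - α * (1 - α) * Real.exp x -
        (1 - α) ^ 3 / α * Real.exp (-x)) := by
  have hα : 0 < α := by linarith
  have hβ : 0 < 1 - α := by linarith
  have hQ : 0 < (2 * α - 1) / α := div_pos (by linarith) hα
  set Q := (2 * α - 1) / α with hQdef
  set A := α * (1 - α)
  set B := (1 - α) ^ 3 / α
  have hA : 0 < A := by positivity
  have hB : 0 < B := by positivity
  have hC : 1 ≤ 1 + (A + B) / Q := by
    have : 0 < (A + B) / Q := by positivity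
    linarith
  refine ⟨1 + (A + B) / Q, hC, fun x hx hCx => ?_⟩
  have hx2 : x ^ 2 ≤ 1 := (le_mul_of_one_le_left (sq_nonneg x) hC).trans hCx
  have habs : |x| ≤ 1 := (sq_le_one_iff_abs_le_one x).1 hx2
  have hx1 := (abs_le.1 habs).1
  have e1 := mul_le_mul_of_nonneg_left (abs_le.1 (Real.abs_exp_sub_one_sub_id_le habs)).2 hA.le
  have e2 := mul_le_mul_of_nonneg_left
    (abs_le.1 (Real.abs_exp_sub_one_sub_id_le (x := -x) (by simpa using habs))).2 hB.le
  have hid : 1 - 2 * (1 - α) ^ 2 - A * (x + 1) - B * (-x + 1) = Q * (1 - (1 - α) * x) := by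
    simp only [A, B, hQdef]
    field_simp
    ring
  have hK : Q * ((1 + (A + B) / Q) * x ^ 2) = (Q + A + B) * x ^ 2 := by
    field_simp
    ring
  have hK' : (Q + A + B) * x ^ 2 ≤ Q := by
    rw [← hK]
    exact mul_le_of_le_one_right hQ.le hCx
  have hβx : 0 ≤ -((1 - α) * x) := by nlinarith
  have hL : 0 ≤ Q * (1 - (1 - α) * x) - (A + B) * x ^ 2 := by
    nlinarith [mul_nonneg hQ.le hβx, mul_nonneg hQ.le (sq_nonneg x)]
  have e3 := Real.add_one_le_exp ((1 - α) * x)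
  have h4 : 0 ≤ (1 - α) * x + 1 := by nlinarith
  calc _ = Q - (Q + A + B) * x ^ 2 := by rw [mul_sub, hK, mul_one]
    _ ≤ ((1 - α) * x + 1) * (Q * (1 - (1 - α) * x) - (A + B) * x ^ 2) := by
        have h5 : (1 - α) ^ 2 * x ^ 2 ≤ x ^ 2 :=
          mul_le_of_le_one_left (sq_nonneg x) (by nlinarith)
        nlinarith [mul_le_mul_of_nonneg_left h5 hQ.le,
          mul_nonneg hβx (mul_nonneg (add_pos hA hB).le (sq_nonneg x))]
    _ ≤ Real.exp ((1 - α) * x) * (Q * (1 - (1 - α) * x) - (A + B) * x ^ 2) := by gcongr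
    _ ≤ _ := by
        refine mul_le_mul_of_nonneg_left ?_ (Real.exp_pos _).le
        rw [even_two.neg_pow] at e2
        linarith

/-- The profile of the boundary of the ball, in the coordinate `log (w / (4α(1-α)))`. -/
theorem rpow_mul_sub_sq_eq {α : ℝ} (h₁ : 1 / 2 < α) (h₂ : α < 1) {w : ℝ} (hw : 0 < w) :
    w ^ (-α) * (w - ((w + 4 * (1 - α) ^ 2) / 2) ^ 2) = (4 * α * (1 - α)) ^ (1 - α) *
      (Real.exp ((1 - α) * Real.log (w / (4 * α * (1 - α)))) *
        (1 - 2 * (1 - α) ^ 2 - α * (1 - α) * Real.exp (Real.log (w / (4 * α * (1 - α)))) -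
      (1 - α) ^ 3 / α * Real.exp (-Real.log (w / (4 * α * (1 - α)))))) := by
  have hα : 0 < α := by linarith
  have hβ : 0 < 1 - α := by linarith
  have hk : 0 < w / (4 * α * (1 - α)) := by positivity
  rw [mul_comm (1 - α) (Real.log _), ← Real.rpow_def_of_pos hk, Real.exp_neg, Real.exp_log hk,
    ← mul_assoc, ← Real.mul_rpow (by positivity) hk.le, mul_div_cancel₀ _ (by positivity),
    sub_eq_add_neg 1 α, add_comm 1 (-α), Real.rpow_add_one hw.ne', mul_assoc]
  congr 1
  have : 1 - α ≠ 0 := hβ.ne'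
  rw [show -α + 1 = 1 - α by ring]
  field_simp
  ring

/-- The boundary profile is maximal at `w = 4α(1-α)`. -/
theorem rpow_mul_sub_sq_le {α : ℝ} (h₁ : 1 / 2 < α) (h₂ : α < 1) {w : ℝ} (hw : 0 < w) :
    w ^ (-α) * (w - ((w + 4 * (1 - α) ^ 2) / 2) ^ 2) ≤
      (4 * α * (1 - α)) ^ (1 - α) * ((2 * α - 1) / α) := by
  have hβ : 0 < 1 - α := by linarith
  rw [rpow_mul_sub_sq_eq h₁ h₂ hw]
  gcongr
  exact exp_mul_profile_le h₁ h₂ _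

theorem le_rpow_mul_sub_sq {α : ℝ} (h₁ : 1 / 2 < α) (h₂ : α < 1) :
    ∃ C : ℝ, 1 ≤ C ∧ ∀ ε > 0, C * ε ^ 2 ≤ 1 → ∀ w,
      4 * α * (1 - α) * Real.exp (-ε) ≤ w → w ≤ 4 * α * (1 - α) →
      (4 * α * (1 - α)) ^ (1 - α) * ((2 * α - 1) / α) * (1 - C * ε ^ 2) ≤
        w ^ (-α) * (w - ((w + 4 * (1 - α) ^ 2) / 2) ^ 2) := by
  have hα : 0 < α := by linarith
  have hβ : 0 < 1 - α := by linarith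
  have hw0 : 0 < 4 * α * (1 - α) := by positivity
  have hQ : 0 < (2 * α - 1) / α := div_pos (by linarith) hα
  obtain ⟨C, hC, h⟩ := le_exp_mul_profile h₁ h₂
  refine ⟨C, hC, fun ε hε hCε w hw hw' => ?_⟩
  have hwpos : 0 < w := lt_of_lt_of_le (by positivity) hw
  have hk : 0 < w / (4 * α * (1 - α)) := by positivity
  have hx0 : Real.log (w / (4 * α * (1 - α))) ≤ 0 :=
    Real.log_nonpos hk.le ((div_le_one hw0).2 hw')
  have hxε : -ε ≤ Real.log (w / (4 * α * (1 - α))) := by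
    rw [Real.le_log_iff_exp_le hk, le_div_iff₀' hw0]
    exact hw
  have hsq : Real.log (w / (4 * α * (1 - α))) ^ 2 ≤ ε ^ 2 :=
    sq_le_sq' hxε (by linarith)
  have hCsq : C * Real.log (w / (4 * α * (1 - α))) ^ 2 ≤ C * ε ^ 2 := by gcongr
  rw [rpow_mul_sub_sq_eq h₁ h₂ hwpos, mul_assoc]
  refine mul_le_mul_of_nonneg_left (le_trans ?_ (h _ hx0 (hCsq.trans hCε))) (by positivity)
  gcongr

theorem muAlpha_setOf_norm_sq_lt {n : ℕ} (p : ℝ) {g : ℝ → ℝ} (hg : Measurable g) :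
    muAlpha (n + 1) p {x | ‖x‖ ^ 2 < g (x 0)} =
      ∫⁻ t : ℝ, ∫⁻ y : EuclideanSpace ℝ (Fin n), (Set.Iio (g t)).indicator
        (fun v => ENNReal.ofReal (v ^ (-p / 2))) (t ^ 2 + ‖y‖ ^ 2) := by
  have hF : Measurable (Function.uncurry fun t v : ℝ => (Set.Iio (g t)).indicator
      (fun v => ENNReal.ofReal (v ^ (-p / 2))) v) := by
    have : MeasurableSet {z : ℝ × ℝ | z.2 < g z.1} :=
      measurableSet_lt measurable_snd (hg.comp measurable_fst)
    exact (Measurable.ennreal_ofReal (by fun_prop) : Measurable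
      fun z : ℝ × ℝ => ENNReal.ofReal (z.2 ^ (-p / 2))).indicator this
  have hS : MeasurableSet {x : EuclideanSpace ℝ (Fin (n + 1)) | ‖x‖ ^ 2 < g (x 0)} :=
    measurableSet_lt (by fun_prop) (hg.comp (by fun_prop))
  rw [← lintegral_euclideanSpace_succ hF, muAlpha, withDensity_apply _ hS, ← lintegral_indicator hS]
  refine lintegral_congr fun x => ?_
  by_cases hx : ‖x‖ ^ 2 < g (x 0)
  · rw [Set.indicator_of_mem (by exact hx), Set.indicator_of_mem (by exact hx),
      ← Real.rpow_natCast, ← Real.rpow_mul (norm_nonneg x)]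
    congr 2
    push_cast
    ring
  · rw [Set.indicator_of_notMem (by exact hx), Set.indicator_of_notMem (by exact hx)]

theorem ball_single_eq {n : ℕ} {r : ℝ} (hr : 0 ≤ r) :
    ball (EuclideanSpace.single (0 : Fin (n + 1)) (1 : ℝ)) r =
      {x | ‖x‖ ^ 2 < 2 * x 0 - (1 - r ^ 2)} := by
  ext x
  have h := norm_sub_sq_real x (EuclideanSpace.single (0 : Fin (n + 1)) (1 : ℝ))
  rw [EuclideanSpace.inner_single_right] at h
  simp only [PiLp.norm_single, norm_one, one_mul, conj_trivial] at h
  rw [mem_ball, dist_eq_norm, ← sq_lt_sq₀ (norm_nonneg _) hr, h, Set.mem_ofPred_eq]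
  constructor <;> intro h <;> linarith

theorem slice_weight_eq {α w v : ℝ} (hw : 0 < w) (hv : 0 ≤ v) (n : ℕ) :
    w ^ (-(α * (n + 1 : ℕ)) / 2) * v ^ ((n : ℝ) / 2) =
      w ^ (-α / 2) * (w ^ (-α) * v) ^ ((n : ℝ) / 2) := by
  rw [Real.mul_rpow (by positivity) hv, ← Real.rpow_mul hw.le, ← mul_assoc, ← Real.rpow_add hw]
  congr 2
  push_cast
  ring

/-- Each slice orthogonal to `e₁` is bounded by the maximum of the boundary profile. -/
theorem muAlpha_ball_single_le {α : ℝ} (h₁ : 1 / 2 < α) (h₂ : α < 1) {n : ℕ}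
    (hn : 2 / (1 - α) ≤ n) :
    muAlpha (n + 1) (α * (n + 1 : ℕ))
        (ball (EuclideanSpace.single (0 : Fin (n + 1)) (1 : ℝ)) (√(1 - 4 * (1 - α) ^ 2))) ≤
      ENNReal.ofReal (4 / (1 - α) * ((4 * (1 - α) ^ 4) ^ (-α / 2) *
        ((4 * α * (1 - α)) ^ (1 - α) * ((2 * α - 1) / α)) ^ ((n : ℝ) / 2))) *
      volume (ball (0 : EuclideanSpace ℝ (Fin n)) 1) := by
  have hα : 0 < α := by linarith
  have hβ : 0 < 1 - α := by linarith
  have hQ : 0 < (2 * α - 1) / α := div_pos (by linarith) hα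
  have hn2 : 2 ≤ (1 - α) * n := by rwa [div_le_iff₀' hβ] at hn
  have hn0 : 0 < n := by
    rcases Nat.eq_zero_or_pos n with rfl | h
    · norm_num at hn2
    · exact h
  have hnp : (1 - α) / 2 * n ≤ n - α * (n + 1 : ℕ) := by
    push_cast
    nlinarith
  have hnR : (0 : ℝ) < n := by exact_mod_cast hn0
  have hnp0 : 0 < (n : ℝ) - α * (n + 1 : ℕ) := lt_of_lt_of_le (by positivity) hnp
  set H := (4 * α * (1 - α)) ^ (1 - α) * ((2 * α - 1) / α)
  have hH : 0 < H := by positivity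
  set κ := volume (ball (0 : EuclideanSpace ℝ (Fin n)) 1)
  have hR : 0 ≤ 1 - 4 * (1 - α) ^ 2 := by nlinarith
  rw [ball_single_eq (Real.sqrt_nonneg _), Real.sq_sqrt hR,
    muAlpha_setOf_norm_sq_lt _ (g := fun t => 2 * t - (1 - (1 - 4 * (1 - α) ^ 2))) (by fun_prop)]
  calc _ ≤ ∫⁻ t, (Set.Ioo (0 : ℝ) 2).indicator (fun _ => ENNReal.ofReal (2 / (1 - α) *
        ((4 * (1 - α) ^ 4) ^ (-α / 2) * H ^ ((n : ℝ) / 2))) * κ) t := by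
        refine lintegral_mono fun t => ?_
        beta_reduce
        rw [sub_sub_cancel]
        set w := 2 * t - 4 * (1 - α) ^ 2 with hwdef
        by_cases htw : t ^ 2 < w
        · have hw0 : 0 < w := (sq_nonneg t).trans_lt htw
          have hβ2 : 0 < (1 - α) ^ 2 := by positivity
          have ht : t = (w + 4 * (1 - α) ^ 2) / 2 := by rw [hwdef]; ring
          have ht0 : 0 < t := by linarith
          have hw4 : 4 * (1 - α) ^ 4 ≤ w := by
            rw [ht] at htw
            nlinarith
          have ht02 : t ∈ Set.Ioo (0 : ℝ) 2 := ⟨ht0, by nlinarith⟩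
          rw [Set.indicator_of_mem ht02]
          refine (lintegral_slice_le hn0 (by positivity) (by linarith) htw).trans ?_
          refine mul_le_mul_left (ENNReal.ofReal_le_ofReal ?_) _
          have hv : 0 ≤ w - t ^ 2 := by linarith
          rw [slice_weight_eq hw0 hv]
          refine mul_le_mul ?_ ?_ (by positivity) (by positivity)
          · rw [div_le_div_iff₀ hnp0 hβ]
            linarith
          · refine mul_le_mul (Real.rpow_le_rpow_of_nonpos (by positivity) hw4 (by linarith)) ?_
              (by positivity) (by positivity)
            refine Real.rpow_le_rpow (by positivity) ?_ (by positivity)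
            have := rpow_mul_sub_sq_le h₁ h₂ hw0
            rwa [← ht] at this
        · refine le_of_eq_of_le ?_ zero_le
          rw [lintegral_eq_zero_of_ae_eq_zero]
          refine Filter.Eventually.of_forall fun y => Set.indicator_of_notMem ?_ _
          simp only [Set.mem_Iio, not_lt]
          nlinarith [sq_nonneg ‖y‖]
    _ = _ := by
        rw [lintegral_indicator measurableSet_Ioo, setLIntegral_const, Real.volume_Ioo,
          mul_right_comm, ← ENNReal.ofReal_mul (by positivity)]
        ring_nf

/-- Slices of `B(e₁,R)` at distance `O(1/√d)` below the critical one lie in `B(0,s₀)` and have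
nearly critical mass. -/
theorem le_muAlpha_ball_single_inter_ball {α : ℝ} (h₁ : 1 / 2 < α) (h₂ : α < 1) :
    ∃ a : ℝ, 0 < a ∧ ∀ n : ℕ, 2 ≤ n →
      ENNReal.ofReal (a / √(n + 1 : ℕ) *
        ((4 * α * (1 - α)) ^ (1 - α) * ((2 * α - 1) / α)) ^ ((n : ℝ) / 2)) *
      volume (ball (0 : EuclideanSpace ℝ (Fin n)) 1) ≤
      muAlpha (n + 1) (α * (n + 1 : ℕ))
        (ball (EuclideanSpace.single (0 : Fin (n + 1)) (1 : ℝ)) (√(1 - 4 * (1 - α) ^ 2)) ∩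
          ball 0 (2 * √(α * (1 - α)))) := by
  have hα : 0 < α := by linarith
  have hβ : 0 < 1 - α := by linarith
  have hQ : 0 < (2 * α - 1) / α := div_pos (by linarith) hα
  obtain ⟨C, hC, hprof⟩ := le_rpow_mul_sub_sq h₁ h₂
  have hw₀ : 0 < 4 * α * (1 - α) := by positivity
  set w₀ := 4 * α * (1 - α) with hw₀def
  set H := w₀ ^ (1 - α) * ((2 * α - 1) / α)
  have hH : 0 < H := by positivity
  refine ⟨w₀ / (4 * √C) * (w₀ ^ (-α / 2) / 2), by positivity, fun n hn => ?_⟩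
  set κ := volume (ball (0 : EuclideanSpace ℝ (Fin n)) 1)
  set ε := (√C * √(n + 1 : ℕ))⁻¹ with hε
  have hε0 : 0 < ε := by positivity
  have hCε : C * ε ^ 2 = 1 / (n + 1) := by
    rw [hε, inv_pow, mul_pow, Real.sq_sqrt (by positivity), Real.sq_sqrt (by positivity)]
    push_cast
    field_simp
  have hCε1 : C * ε ^ 2 ≤ 1 := by
    rw [hCε, div_le_one (by positivity)]
    linarith [n.cast_nonneg (α := ℝ)]
  have hε1 : ε ≤ 1 := by
    have : ε ^ 2 ≤ 1 := (le_mul_of_one_le_left (sq_nonneg ε) hC).trans hCε1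
    nlinarith
  have hR : 0 ≤ 1 - 4 * (1 - α) ^ 2 := by nlinarith
  have hset : ball (EuclideanSpace.single (0 : Fin (n + 1)) (1 : ℝ)) (√(1 - 4 * (1 - α) ^ 2)) ∩
      ball 0 (2 * √(α * (1 - α))) =
      {x | ‖x‖ ^ 2 < min (2 * x 0 - 4 * (1 - α) ^ 2) w₀} := by
    rw [ball_single_eq (Real.sqrt_nonneg _), Real.sq_sqrt hR, sub_sub_cancel]
    ext x
    rw [Set.mem_inter_iff, Set.mem_ofPred_eq, Set.mem_ofPred_eq, lt_min_iff, mem_ball_zero_iff,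
      ← sq_lt_sq₀ (norm_nonneg x) (by positivity), mul_pow, Real.sq_sqrt (by positivity)]
    norm_num [hw₀def, mul_assoc]
  rw [hset, muAlpha_setOf_norm_sq_lt _ (g := fun t => min (2 * t - 4 * (1 - α) ^ 2) w₀)
    (by fun_prop)]
  set t₁ := (w₀ * Real.exp (-ε) + 4 * (1 - α) ^ 2) / 2 with ht₁
  set t₀ := (w₀ + 4 * (1 - α) ^ 2) / 2 with ht₀
  have hlen : w₀ * ε / 4 ≤ t₀ - t₁ := by
    have hmono : Real.exp (-ε) ≤ 1 - ε / 2 := by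
      rw [Real.exp_neg, inv_le_iff_one_le_mul₀ (Real.exp_pos ε)]
      nlinarith [Real.add_one_le_exp ε]
    rw [ht₀, ht₁]
    nlinarith
  have hbern : 1 / 2 ≤ (1 - C * ε ^ 2) ^ ((n : ℝ) / 2) := by
    have hn' : (2 : ℝ) ≤ n := by exact_mod_cast hn
    have h := one_add_mul_self_le_rpow_one_add (s := -(C * ε ^ 2)) (by linarith)
      (p := (n : ℝ) / 2) (by linarith)
    rw [← sub_eq_add_neg] at h
    refine le_trans ?_ h
    rw [hCε]
    have : (n : ℝ) / 2 * (1 / (n + 1)) ≤ 1 / 2 := by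
      rw [div_mul_div_comm, div_le_div_iff₀ (by positivity) (by positivity)]
      linarith
    linarith
  calc _ ≤ ENNReal.ofReal (t₀ - t₁) *
        (ENNReal.ofReal (w₀ ^ (-α / 2) / 2 * H ^ ((n : ℝ) / 2)) * κ) := by
        rw [← mul_assoc, ← ENNReal.ofReal_mul (le_trans (by positivity) hlen)]
        refine mul_le_mul_left (ENNReal.ofReal_le_ofReal ?_) _
        refine le_trans (le_of_eq ?_) (mul_le_mul_of_nonneg_right hlen (by positivity))
        rw [hε]
        field_simp
    _ = ∫⁻ t, (Set.Ioo t₁ t₀).indicator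
        (fun _ => ENNReal.ofReal (w₀ ^ (-α / 2) / 2 * H ^ ((n : ℝ) / 2)) * κ) t := by
        rw [lintegral_indicator measurableSet_Ioo, setLIntegral_const, Real.volume_Ioo, mul_comm]
    _ ≤ _ := by
        refine lintegral_mono fun t => ?_
        beta_reduce
        by_cases ht : t ∈ Set.Ioo t₁ t₀
        · rw [Set.indicator_of_mem ht]
          obtain ⟨ht1, ht2⟩ := ht
          set w := 2 * t - 4 * (1 - α) ^ 2 with hwdef
          have htw : t = (w + 4 * (1 - α) ^ 2) / 2 := by rw [hwdef]; ring
          have hw1 : w₀ * Real.exp (-ε) ≤ w := by linarith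
          have hw2 : w ≤ w₀ := by linarith
          have hw : 0 < w := lt_of_lt_of_le (by positivity) hw1
          have hp := hprof ε hε0 hCε1 w hw1 hw2
          rw [← htw] at hp
          have hCε2 : C * ε ^ 2 < 1 := by
            rw [hCε, div_lt_one (by positivity)]
            have : (2 : ℝ) ≤ n := by exact_mod_cast hn
            linarith
          have hpos : 0 < H * (1 - C * ε ^ 2) := mul_pos hH (by linarith)
          have hv : 0 < w - t ^ 2 := pos_of_mul_pos_right (hpos.trans_le hp) (by positivity)
          have ht0 : 0 < t := by
            rw [htw]
            positivity
          rw [min_eq_left hw2]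
          refine le_trans ?_ (le_lintegral_slice (by positivity) ht0.ne' (by linarith))
          refine mul_le_mul_left (ENNReal.ofReal_le_ofReal ?_) _
          rw [slice_weight_eq hw hv.le]
          calc w₀ ^ (-α / 2) / 2 * H ^ ((n : ℝ) / 2)
              = w₀ ^ (-α / 2) * (H ^ ((n : ℝ) / 2) * (1 / 2)) := by ring
            _ ≤ w ^ (-α / 2) * (H ^ ((n : ℝ) / 2) * (1 - C * ε ^ 2) ^ ((n : ℝ) / 2)) := by
                refine mul_le_mul (Real.rpow_le_rpow_of_nonpos hw hw2 (by linarith)) ?_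
                  (by positivity) (by positivity)
                gcongr
            _ ≤ _ := by
                rw [← Real.mul_rpow hH.le (by linarith)]
                gcongr
        · rw [Set.indicator_of_notMem ht]
          exact zero_le

/-- For fixed `1/2 < α < 1`, with `R = √(1 − 4(1−α)²)`, `s₀ = 2√(α(1−α))` and
`dμ_d(x) = ‖x‖₂^{-αd} dx` on `ℝ^d`, there are `c = c(α) > 0` and `d₀` such that for all `d ≥ d₀`,
`μ_d(B(e₁,R) ∩ B(0,s₀)) / μ_d(B(e₁,R)) ≥ c/√d`. -/
theorem ball_intersection_ratio_lower_bound (α : ℝ) (hα₁ : 1 / 2 < α) (hα₂ : α < 1) :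
    ∃ c : ℝ, 0 < c ∧ ∃ d₀ : ℕ, ∀ d : ℕ, ∀ _hd : d₀ + 1 ≤ d,
      ENNReal.ofReal (c / Real.sqrt d) ≤
        (muAlpha d (α * d))
            (ball (EuclideanSpace.single (⟨0, by omega⟩ : Fin d) (1 : ℝ))
                (Real.sqrt (1 - 4 * (1 - α) ^ 2)) ∩
              ball 0 (2 * Real.sqrt (α * (1 - α)))) /
          (muAlpha d (α * d))
            (ball (EuclideanSpace.single (⟨0, by omega⟩ : Fin d) (1 : ℝ))
              (Real.sqrt (1 - 4 * (1 - α) ^ 2))) := by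
  have hα : 0 < α := by linarith
  have hβ : 0 < 1 - α := by linarith
  have hQ : 0 < (2 * α - 1) / α := div_pos (by linarith) hα
  obtain ⟨a, ha, hnum⟩ := le_muAlpha_ball_single_inter_ball hα₁ hα₂
  set b := 4 / (1 - α) * (4 * (1 - α) ^ 4) ^ (-α / 2) with hb
  have hb0 : 0 < b := by positivity
  refine ⟨a / b, by positivity, ⌈2 / (1 - α)⌉₊ + 2, fun d hd => ?_⟩
  obtain ⟨n, rfl⟩ : ∃ n, d = n + 1 := ⟨d - 1, by omega⟩
  have hden := muAlpha_ball_single_le hα₁ hα₂ (n := n)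
    ((Nat.le_ceil _).trans (by exact_mod_cast (by omega : ⌈2 / (1 - α)⌉₊ ≤ n)))
  have hnum := hnum n (by omega)
  rw [← mul_assoc, ← hb] at hden
  set H := (4 * α * (1 - α)) ^ (1 - α) * ((2 * α - 1) / α)
  have hH : 0 < H := by positivity
  have hκ : volume (ball (0 : EuclideanSpace ℝ (Fin n)) 1) ≠ ⊤ := measure_ball_lt_top.ne
  have hκ0 : volume (ball (0 : EuclideanSpace ℝ (Fin n)) 1) ≠ 0 :=
    (measure_ball_pos _ _ one_pos).ne'
  have hpos : 0 < a / √(n + 1 : ℕ) * H ^ ((n : ℝ) / 2) := by positivity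
  refine (ENNReal.le_div_iff_mul_le (Or.inr ?_) (Or.inl ?_)).2 ?_
  · exact ((ENNReal.mul_pos (ENNReal.ofReal_pos.2 hpos).ne' hκ0).trans_le hnum).ne'
  · exact (hden.trans_lt (ENNReal.mul_lt_top ENNReal.ofReal_lt_top hκ.lt_top)).ne
  · refine (mul_le_mul_right hden _).trans (le_trans (le_of_eq ?_) hnum)
    rw [← mul_assoc, ← ENNReal.ofReal_mul (by positivity)]
    congr 2
    field_simp
end

section
/- Fix 1/2 < α < 1 and set R² = 1 − 4(1−α)². The function g(t) = [4t − (1 + t − R²)²] · t^{-α}, defined on the interval [(1−R)², (1+R)²], vanishes at both endpoints, attains its maximum over this interval at the unique point t₀ = 4α(1−α), and moreover t₀ < 1. Consequently the function F_R(s) = (1/4)[4s² − (1 + s² − R²)²] · s^{-2α} on [1−R, 1+R] attains its unique maximum at s₀ = 2√(α(1−α)) < 1. -/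
open Real Set

/-- With `P t = 4 t - (t + 4 b²)²`, the function `t ↦ P t * t ^ (b - 1)` on `(0, ∞)` is strictly
smaller at every other point than at `4 b (1 - b)`. The proof is Bernoulli's inequality for
`(t / t₀) ^ b`, followed by a factorization of a cubic. -/
theorem quadratic_mul_rpow_lt {b t t₀ : ℝ} (hb₀ : 0 < b) (hb : b < 1 / 2) (ht : 0 < t)
    (ht₀ : t₀ = 4 * b * (1 - b)) (hne : t ≠ t₀) :
    (4 * t - (t + 4 * b ^ 2) ^ 2) * t ^ (b - 1) <
      (4 * t₀ - (t₀ + 4 * b ^ 2) ^ 2) * t₀ ^ (b - 1) := by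
  have hb₁ : 0 < 1 - b := by linarith
  have ht₀_pos : 0 < t₀ := by rw [ht₀]; positivity
  obtain ⟨x, rfl⟩ : ∃ x, t = x * t₀ := ⟨t / t₀, by field_simp⟩
  have hx : 0 < x := pos_of_mul_pos_left ht ht₀_pos.le
  have hx_ne : x ≠ 1 := by rintro rfl; simp at hne
  have hbern : x ^ b < 1 + b * (x - 1) := by
    simpa using rpow_one_add_lt_one_add_mul_self (s := x - 1) (by linarith)
      (sub_ne_zero.2 hx_ne) hb₀ (by linarith)
  have hmax : 4 * t₀ - (t₀ + 4 * b ^ 2) ^ 2 = 16 * b * (1 - 2 * b) := by rw [ht₀]; ring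
  have hmax_pos : 0 < 16 * b * (1 - 2 * b) := mul_pos (by positivity) (by linarith)
  have hcubic : (4 * (x * t₀) - (x * t₀ + 4 * b ^ 2) ^ 2) * (1 + b * (x - 1)) ≤
      16 * b * (1 - 2 * b) * x := by
    have hfactor : 16 * b * (1 - 2 * b) * x -
        (4 * (x * t₀) - (x * t₀ + 4 * b ^ 2) ^ 2) * (1 + b * (x - 1)) =
        (x - 1) ^ 2 * (b * t₀ ^ 2 * x + 16 * b ^ 4 * (1 - b)) := by rw [ht₀]; ring
    have : 0 ≤ (x - 1) ^ 2 * (b * t₀ ^ 2 * x + 16 * b ^ 4 * (1 - b)) := by positivity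
    linarith
  have hkey : (4 * (x * t₀) - (x * t₀ + 4 * b ^ 2) ^ 2) * x ^ b < 16 * b * (1 - 2 * b) * x := by
    rcases le_or_gt (4 * (x * t₀) - (x * t₀ + 4 * b ^ 2) ^ 2) 0 with hP | hP
    · exact (mul_nonpos_of_nonpos_of_nonneg hP (rpow_nonneg hx.le b)).trans_lt
        (mul_pos hmax_pos hx)
    · exact (mul_lt_mul_of_pos_left hbern hP).trans_le hcubic
  rw [hmax, mul_rpow hx.le ht₀_pos.le, rpow_sub_one hx.ne', ← mul_assoc]
  refine mul_lt_mul_of_pos_right ?_ (rpow_pos_of_pos ht₀_pos _)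
  rwa [← mul_div_assoc, div_lt_iff₀ hx]

/-- The claim in the proof of Part 1): for `1/2 < α < 1` and `R² = 1 − 4(1−α)²`, the function
`g(t) = [4t − (1 + t − R²)²] t^{-α}` on `[(1−R)², (1+R)²]` vanishes at both endpoints and attains
its maximum over this interval at the unique point `t₀ = 4α(1−α) < 1`; consequently
`F_R(s) = (1/4)[4s² − (1 + s² − R²)²] s^{-2α}` on `[1−R, 1+R]` attains its unique maximum at
`s₀ = 2√(α(1−α)) < 1`. -/
theorem claim_unique_maximum (α : ℝ) (hα₁ : 1 / 2 < α) (hα₂ : α < 1)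
    (R : ℝ) (hR : R = Real.sqrt (1 - 4 * (1 - α) ^ 2))
    (g : ℝ → ℝ) (hg : g = fun t => (4 * t - (1 + t - R ^ 2) ^ 2) * t ^ (-α))
    (t₀ : ℝ) (ht₀ : t₀ = 4 * α * (1 - α))
    (F : ℝ → ℝ) (hF : F = fun s => (1 / 4) * (4 * s ^ 2 - (1 + s ^ 2 - R ^ 2) ^ 2) * s ^ (-(2 * α)))
    (s₀ : ℝ) (hs₀ : s₀ = 2 * Real.sqrt (α * (1 - α))) :
    g ((1 - R) ^ 2) = 0 ∧ g ((1 + R) ^ 2) = 0 ∧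
    t₀ ∈ Icc ((1 - R) ^ 2) ((1 + R) ^ 2) ∧
    (∀ t ∈ Icc ((1 - R) ^ 2) ((1 + R) ^ 2), t ≠ t₀ → g t < g t₀) ∧
    t₀ < 1 ∧
    s₀ ∈ Icc (1 - R) (1 + R) ∧
    (∀ s ∈ Icc (1 - R) (1 + R), s ≠ s₀ → F s < F s₀) ∧
    s₀ < 1 := by
  have hrad : 0 < 1 - 4 * (1 - α) ^ 2 := by nlinarith
  have hR_sq : R ^ 2 = 1 - 4 * (1 - α) ^ 2 := by rw [hR, sq_sqrt hrad.le]
  have hR_nonneg : 0 ≤ R := hR ▸ sqrt_nonneg _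
  have hR_lt : R < 1 := by nlinarith
  have hprod : 0 < α * (1 - α) := mul_pos (by linarith) (by linarith)
  have hs₀_nonneg : 0 ≤ s₀ := by rw [hs₀]; positivity
  have hs₀_sq : s₀ ^ 2 = t₀ := by rw [hs₀, ht₀, mul_pow, sq_sqrt hprod.le]; ring
  have ht₀_lt : t₀ < 1 := by nlinarith
  have hs₀_lt : s₀ < 1 := by nlinarith
  have hs₀_ge : 2 * (1 - α) ≤ s₀ := by
    refine abs_le_of_sq_le_sq' ?_ hs₀_nonneg |>.2
    nlinarith
  have hs₀_mem : s₀ ∈ Icc (1 - R) (1 + R) := by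
    have : (s₀ - 1) ^ 2 ≤ R ^ 2 := by nlinarith
    obtain ⟨h₁, h₂⟩ := abs_le_of_sq_le_sq' this hR_nonneg
    constructor <;> linarith
  have hg_lt : ∀ t, 0 < t → t ≠ t₀ → g t < g t₀ := by
    intro t ht hne
    have h := quadratic_mul_rpow_lt (b := 1 - α) (by linarith) (by linarith) ht
      (by rw [ht₀]; ring) hne
    have hshift : ∀ u, 1 + u - R ^ 2 = u + 4 * (1 - α) ^ 2 := fun u => by rw [hR_sq]; ring
    have hexp : 1 - α - 1 = -α := by ring
    simpa only [hg, hshift, hexp] using h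
  have hFg : ∀ s, 0 ≤ s → F s = 1 / 4 * g (s ^ 2) := by
    intro s hs
    have hpow : s ^ (-(2 * α)) = (s ^ 2) ^ (-α) := by
      rw [← rpow_natCast_mul hs]
      congr 1
      push_cast
      ring
    simp only [hF, hg, hpow]
    ring
  refine ⟨?_, ?_, ?_, ?_, ht₀_lt, hs₀_mem, ?_, hs₀_lt⟩
  · simp only [hg]
    ring
  · simp only [hg]
    ring
  · rw [← hs₀_sq]
    exact ⟨pow_le_pow_left₀ (by linarith) hs₀_mem.1 2, pow_le_pow_left₀ hs₀_nonneg hs₀_mem.2 2⟩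
  · intro t ht
    exact hg_lt t ((pow_pos (sub_pos.2 hR_lt) 2).trans_le ht.1)
  · intro s hs hne
    have hs_pos : 0 < s := (sub_pos.2 hR_lt).trans_le hs.1
    have hsq_ne : s ^ 2 ≠ t₀ := by
      rw [← hs₀_sq]
      exact fun h => hne ((pow_left_inj₀ hs_pos.le hs₀_nonneg two_ne_zero).1 h)
    rw [hFg s hs_pos.le, hFg s₀ hs₀_nonneg, hs₀_sq]
    linarith [hg_lt (s ^ 2) (by positivity) hsq_ne]
end

section
/- Let d ≥ 2 and 0 < α < d, let μ_α be the measure on ℝ^d with density dμ_α(x) = ‖x‖₂^{-α} dx, and let e₁ be the first standard basis vector. Then μ_α(B(0,1)) / μ_α(B(e₁,1)) = √π · Γ((2d−α)/2) / (2^{d−α−1} · Γ(d/2) · Γ((d−α+1)/2)). -/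
open MeasureTheory Metric

open Set in
/-- Integration in polar coordinates, for the Lebesgue integral. -/
theorem lintegral_eq_lintegral_toSphere {E : Type*} [NormedAddCommGroup E] [NormedSpace ℝ E]
    [MeasurableSpace E] [BorelSpace E] [FiniteDimensional ℝ E] [Nontrivial E]
    (μ : Measure E) [μ.IsAddHaarMeasure] {f : E → ENNReal} (hf : Measurable f) :
    ∫⁻ x, f x ∂μ = ∫⁻ ω, (∫⁻ r in Ioi (0 : ℝ),
      ENNReal.ofReal (r ^ (Module.finrank ℝ E - 1)) * f (r • (ω : E))) ∂μ.toSphere := by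
  let g : sphere (0 : E) 1 × Ioi (0 : ℝ) → ENNReal := fun p => f (p.2.1 • (p.1 : E))
  have hg : Measurable g := by
    apply hf.comp
    fun_prop
  calc ∫⁻ x, f x ∂μ = ∫⁻ x : ({0}ᶜ : Set E), f x ∂(μ.comap (↑)) := by
        rw [lintegral_subtype_comap (measurableSet_singleton _).compl, restrict_compl_singleton]
    _ = ∫⁻ x : ({0}ᶜ : Set E), g (homeomorphUnitSphereProd E x) ∂(μ.comap (↑)) := by
        refine lintegral_congr fun x => ?_
        have hx : ‖(x : E)‖ ≠ 0 := norm_ne_zero_iff.2 x.2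
        simp [g, smul_smul, hx]
    _ = ∫⁻ p, g p ∂(μ.toSphere.prod (.volumeIoiPow (Module.finrank ℝ E - 1))) :=
        μ.measurePreserving_homeomorphUnitSphereProd.lintegral_comp hg
    _ = _ := by
        rw [lintegral_prod _ hg.aemeasurable]
        refine lintegral_congr fun ω => ?_
        rw [Measure.volumeIoiPow, lintegral_withDensity_eq_lintegral_mul _ (by fun_prop)
          (g := fun r => g (ω, r)) (hg.comp measurable_prodMk_left)]
        exact lintegral_subtype_comap measurableSet_Ioi
          fun r : ℝ => ENNReal.ofReal (r ^ (Module.finrank ℝ E - 1)) * f (r • (ω : E))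

open Set in
theorem lintegral_Ioo_rpow_sub_one {s ρ : ℝ} (hs : 0 < s) (hρ : 0 ≤ ρ) :
    ∫⁻ r in Ioo 0 ρ, ENNReal.ofReal (r ^ (s - 1)) = ENNReal.ofReal (ρ ^ s / s) := by
  have h := intervalIntegral.intervalIntegrable_rpow' (a := 0) (b := ρ) (r := s - 1) (by linarith)
  rw [Measure.restrict_congr_set Ioo_ae_eq_Ioc, ← ofReal_integral_eq_lintegral_ofReal h.1,
    ← intervalIntegral.integral_of_le hρ, integral_rpow (Or.inl (by linarith))]
  · simp [hs.ne']
  · filter_upwards [ae_restrict_mem measurableSet_Ioc] with r hr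
    exact Real.rpow_nonneg hr.1.le _

open Set in
theorem lintegral_Ioi_rpow_mul_exp_neg_sq {q : ℝ} (hq : -1 < q) :
    ∫⁻ r in Ioi (0 : ℝ), ENNReal.ofReal (r ^ q * Real.exp (-r ^ 2)) =
      ENNReal.ofReal (Real.Gamma ((q + 1) / 2) / 2) := by
  have hi : IntegrableOn (fun r : ℝ => r ^ q * Real.exp (-r ^ 2)) (Ioi 0) := by
    simpa using integrableOn_rpow_mul_exp_neg_mul_sq one_pos hq
  have h := integral_rpow_mul_exp_neg_rpow (p := 2) (q := q) two_pos hq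
  simp only [Real.rpow_two] at h
  rw [← ofReal_integral_eq_lintegral_ofReal hi, h]
  · congr 1
    ring
  · filter_upwards [ae_restrict_mem measurableSet_Ioi] with r hr
    exact mul_nonneg (Real.rpow_nonneg (le_of_lt hr) _) (Real.exp_nonneg _)

/-- The `μ_α`-measure of a set that is star-shaped about the origin with radial function `ρ`. -/
theorem muAlpha_eq_lintegral_toSphere {d : ℕ} (hd : 2 ≤ d) {α : ℝ} (hαd : α < d)
    {S : Set (EuclideanSpace ℝ (Fin d))} (hS : MeasurableSet S)
    {ρ : sphere (0 : EuclideanSpace ℝ (Fin d)) 1 → ℝ} (hρ : ∀ ω, 0 ≤ ρ ω)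
    (hSρ : ∀ ω : sphere (0 : EuclideanSpace ℝ (Fin d)) 1, ∀ r : ℝ, 0 < r →
      (r • (ω : EuclideanSpace ℝ (Fin d)) ∈ S ↔ r < ρ ω)) :
    muAlpha d α S = ∫⁻ ω, ENNReal.ofReal (ρ ω ^ ((d : ℝ) - α) / (d - α))
      ∂(volume : Measure (EuclideanSpace ℝ (Fin d))).toSphere := by
  have : NeZero d := ⟨by omega⟩
  have hm : Measurable fun x : EuclideanSpace ℝ (Fin d) => ENNReal.ofReal (‖x‖ ^ (-α)) := by
    fun_prop
  rw [muAlpha, withDensity_apply _ hS, ← lintegral_indicator hS,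
    lintegral_eq_lintegral_toSphere _ (hm.indicator hS)]
  refine lintegral_congr fun ω => ?_
  rw [← lintegral_Ioo_rpow_sub_one (sub_pos.2 hαd) (hρ ω), ← lintegral_indicator measurableSet_Ioi,
    ← lintegral_indicator measurableSet_Ioo]
  refine lintegral_congr fun r => ?_
  by_cases hr : 0 < r
  · by_cases hrρ : r < ρ ω
    · rw [Set.indicator_of_mem (Set.mem_Ioi.2 hr), Set.indicator_of_mem ((hSρ ω r hr).2 hrρ),
        Set.indicator_of_mem (Set.mem_Ioo.2 ⟨hr, hrρ⟩), ← ENNReal.ofReal_mul (by positivity)]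
      congr 1
      rw [norm_smul, norm_eq_of_mem_sphere ω, mul_one, Real.norm_of_nonneg hr.le,
        ← Real.rpow_natCast, ← Real.rpow_add hr, finrank_euclideanSpace_fin,
        Nat.cast_sub (by omega)]
      congr 1
      push_cast
      ring
    · rw [Set.indicator_of_mem (Set.mem_Ioi.2 hr),
        Set.indicator_of_notMem (mt (hSρ ω r hr).1 hrρ),
        Set.indicator_of_notMem (fun h => hrρ h.2), mul_zero]
  · rw [Set.indicator_of_notMem (mt Set.mem_Ioi.1 hr), Set.indicator_of_notMem (fun h => hr h.1)]

theorem smul_mem_ball_single_iff {ι : Type*} [Fintype ι] [DecidableEq ι] (i : ι)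
    (ω : sphere (0 : EuclideanSpace ℝ ι) 1) {r : ℝ} (hr : 0 < r) :
    r • (ω : EuclideanSpace ℝ ι) ∈ ball (EuclideanSpace.single i (1 : ℝ)) 1 ↔
      r < 2 * max ((ω : EuclideanSpace ℝ ι) i) 0 := by
  rw [mem_ball, dist_eq_norm, ← sq_lt_one_iff₀ (norm_nonneg _), @norm_sub_sq_real,
    norm_smul, norm_eq_of_mem_sphere ω, real_inner_smul_left, EuclideanSpace.inner_single_right,
    PiLp.norm_single, Real.norm_of_nonneg hr.le]
  simp only [conj_trivial, norm_one, one_mul, mul_one, one_pow]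
  rw [mul_max_of_nonneg _ _ zero_le_two, mul_zero, lt_max_iff, or_iff_left hr.not_gt]
  constructor
  · intro h
    nlinarith
  · intro h
    nlinarith

/-- **Tonelli's theorem** for a product of functions of one variable each. -/
theorem lintegral_fin_nat_prod_eq_prod {n : ℕ} {E : Fin n → Type*}
    {mE : ∀ i, MeasurableSpace (E i)} (μ : (i : Fin n) → Measure (E i)) [∀ i, SigmaFinite (μ i)]
    {f : (i : Fin n) → E i → ENNReal} (hf : ∀ i, Measurable (f i)) :
    ∫⁻ x : (i : Fin n) → E i, ∏ i, f i (x i) ∂Measure.pi μ = ∏ i, ∫⁻ x, f i x ∂μ i := by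
  induction n with
  | zero => simp
  | succ n ih =>
    calc ∫⁻ x, ∏ i, f i (x i) ∂Measure.pi μ
        = ∫⁻ x : E 0 × ((i : Fin n) → E (Fin.succ i)), f 0 x.1 * ∏ i, f (Fin.succ i) (x.2 i)
            ∂(μ 0).prod (Measure.pi fun i => μ (Fin.succ i)) := by
          rw [← ((measurePreserving_piFinSuccAbove μ 0).symm).lintegral_comp_emb
            (MeasurableEquiv.measurableEmbedding _)]
          simp only [Fin.prod_univ_succ, Fin.zero_succAbove]
          rfl
      _ = ∏ i, ∫⁻ x, f i x ∂μ i := by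
          rw [lintegral_prod_mul (f := f 0)
            (g := fun y : (i : Fin n) → E (Fin.succ i) => ∏ i, f (Fin.succ i) (y i))
            (hf 0).aemeasurable (Measurable.aemeasurable (by fun_prop)), ih _ fun i => hf _,
            Fin.prod_univ_succ]

/-- **Tonelli's theorem** for a product of functions of one variable each. -/
theorem lintegral_fintype_prod_eq_prod {ι : Type*} [Fintype ι] {E : ι → Type*}
    {mE : ∀ i, MeasurableSpace (E i)} (μ : (i : ι) → Measure (E i)) [∀ i, SigmaFinite (μ i)]
    {f : (i : ι) → E i → ENNReal} (hf : ∀ i, Measurable (f i)) :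
    ∫⁻ x : (i : ι) → E i, ∏ i, f i (x i) ∂Measure.pi μ = ∏ i, ∫⁻ x, f i x ∂μ i := by
  let e := (Fintype.equivFin ι).symm
  rw [← (measurePreserving_piCongrLeft μ e).lintegral_comp_emb
    (MeasurableEquiv.measurableEmbedding _)]
  simp_rw [← e.prod_comp, MeasurableEquiv.coe_piCongrLeft, Equiv.piCongrLeft_apply_apply]
  exact lintegral_fin_nat_prod_eq_prod _ fun i => hf _

/-- The Gaussian integral of `max xᵢ 0 ^ s`. -/
theorem lintegral_max_rpow_mul_exp_neg_norm_sq {ι : Type*} [Fintype ι] [DecidableEq ι] (i : ι)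
    {s : ℝ} (hs : 0 < s) :
    ∫⁻ x : EuclideanSpace ℝ ι, ENNReal.ofReal (max (x i) 0 ^ s * Real.exp (-‖x‖ ^ 2)) =
      ENNReal.ofReal (Real.Gamma ((s + 1) / 2) / 2 * √Real.pi ^ (Fintype.card ι - 1)) := by
  let f : ι → ℝ → ENNReal := fun j t =>
    ENNReal.ofReal ((if j = i then max t 0 ^ s else 1) * Real.exp (-t ^ 2))
  have hf : ∀ j, Measurable (f j) := by
    intro j
    by_cases hj : j = i <;> simp only [f, hj, if_true, if_false] <;> fun_prop
  have hfi : ∫⁻ t, f i t = ENNReal.ofReal (Real.Gamma ((s + 1) / 2) / 2) := by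
    rw [← lintegral_Ioi_rpow_mul_exp_neg_sq (by linarith), ← lintegral_indicator measurableSet_Ioi]
    refine lintegral_congr fun t => ?_
    by_cases ht : 0 < t
    · simp [f, ht, ht.le]
    · simp [f, ht, max_eq_right (not_lt.1 ht), Real.zero_rpow hs.ne']
  have hfj : ∀ j, j ≠ i → ∫⁻ t, f j t = ENNReal.ofReal √Real.pi := by
    intro j hj
    have h := integral_gaussian 1
    have hi := integrable_exp_neg_mul_sq one_pos
    simp only [neg_mul, one_mul, div_one] at h hi
    rw [← h, ofReal_integral_eq_lintegral_ofReal hi (.of_forall fun _ => Real.exp_nonneg _)]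
    simp [f, hj]
  calc _ = ∫⁻ x : EuclideanSpace ℝ ι, ∏ j, f j (x j) := by
        refine lintegral_congr fun x => ?_
        rw [← ENNReal.ofReal_prod_of_nonneg (fun j _ => by split_ifs <;> positivity),
          Finset.prod_mul_distrib, Finset.prod_ite_eq', ← Real.exp_sum,
          Finset.sum_neg_distrib, ← EuclideanSpace.real_norm_sq_eq]
        simp
    _ = ∫⁻ x : ι → ℝ, ∏ j, f j (x j) :=
        (PiLp.volume_preserving_ofLp ι).lintegral_comp
          (f := fun x : ι → ℝ => ∏ j, f j (x j)) (by fun_prop)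
    _ = ∏ j, ∫⁻ t, f j t := lintegral_fintype_prod_eq_prod _ hf
    _ = _ := by
        rw [← Finset.mul_prod_erase _ _ (Finset.mem_univ i), hfi,
          Finset.prod_congr rfl fun j hj => hfj j (Finset.ne_of_mem_erase hj), Finset.prod_const,
          Finset.card_erase_of_mem (Finset.mem_univ i), Finset.card_univ,
          ← ENNReal.ofReal_pow (by positivity), ← ENNReal.ofReal_mul (by
            have := Real.Gamma_pos_of_pos (show 0 < (s + 1) / 2 by linarith)
            positivity)]

/-- The moment of order `s` of the positive part of a coordinate on the unit sphere. -/
theorem lintegral_toSphere_max_rpow {ι : Type*} [Fintype ι] [DecidableEq ι] (i : ι)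
    {s : ℝ} (hs : 0 < s) :
    ∫⁻ ω, ENNReal.ofReal (max ((ω : EuclideanSpace ℝ ι) i) 0 ^ s)
      ∂(volume : Measure (EuclideanSpace ℝ ι)).toSphere =
      ENNReal.ofReal (Real.Gamma ((s + 1) / 2) * √Real.pi ^ (Fintype.card ι - 1) /
        Real.Gamma ((Fintype.card ι + s) / 2)) := by
  have : Nonempty ι := ⟨i⟩
  have hcard : 1 ≤ Fintype.card ι := Fintype.card_pos
  have hΓ : 0 < Real.Gamma ((Fintype.card ι + s) / 2) := Real.Gamma_pos_of_pos (by positivity)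
  have hm : Measurable fun x : EuclideanSpace ℝ ι =>
      ENNReal.ofReal (max (x i) 0 ^ s * Real.exp (-‖x‖ ^ 2)) := by fun_prop
  have h := lintegral_max_rpow_mul_exp_neg_norm_sq i hs
  rw [lintegral_eq_lintegral_toSphere _ hm] at h
  have hr : ∀ ω : sphere (0 : EuclideanSpace ℝ ι) 1, ∫⁻ r in Set.Ioi (0 : ℝ),
      ENNReal.ofReal (r ^ (Module.finrank ℝ (EuclideanSpace ℝ ι) - 1)) *
        ENNReal.ofReal (max ((r • (ω : EuclideanSpace ℝ ι)) i) 0 ^ s *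
          Real.exp (-‖r • (ω : EuclideanSpace ℝ ι)‖ ^ 2)) =
      ENNReal.ofReal (max ((ω : EuclideanSpace ℝ ι) i) 0 ^ s) *
        ENNReal.ofReal (Real.Gamma ((Fintype.card ι + s) / 2) / 2) := by
    intro ω
    have hq : (Fintype.card ι + s) / 2 = (Fintype.card ι - 1 + s + 1) / 2 := by ring
    have hc : (1 : ℝ) ≤ Fintype.card ι := by exact_mod_cast hcard
    rw [hq, ← lintegral_Ioi_rpow_mul_exp_neg_sq (by linarith),
      ← lintegral_const_mul _ (by fun_prop)]
    refine setLIntegral_congr_fun measurableSet_Ioi fun r (hr : 0 < r) => ?_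
    simp only
    rw [← ENNReal.ofReal_mul (by positivity), ← ENNReal.ofReal_mul (by positivity)]
    congr 1
    have hmax : max ((r • (ω : EuclideanSpace ℝ ι)) i) 0 =
        r * max ((ω : EuclideanSpace ℝ ι) i) 0 := by
      rw [mul_max_of_nonneg _ _ hr.le, mul_zero]
      rfl
    rw [hmax, Real.mul_rpow hr.le (le_max_right _ _), norm_smul, norm_eq_of_mem_sphere ω, mul_one,
      Real.norm_of_nonneg hr.le, Real.rpow_add hr, finrank_euclideanSpace, ← Real.rpow_natCast,
      Nat.cast_sub hcard, Nat.cast_one]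
    ring
  rw [lintegral_congr hr, lintegral_mul_const _ (by fun_prop)] at h
  rw [← ENNReal.mul_left_inj (c := ENNReal.ofReal (Real.Gamma ((Fintype.card ι + s) / 2) / 2))
    (by simpa using hΓ) ENNReal.ofReal_ne_top, h, ← ENNReal.ofReal_mul' (by positivity)]
  congr 1
  field_simp

/-- For `d ≥ 2` and `0 < α < d`,
`μ_α(B(0,1))/μ_α(B(e₁,1)) = √π Γ((2d−α)/2) / (2^{d−α−1} Γ(d/2) Γ((d−α+1)/2))`. -/
theorem muAlpha_ball_ratio_gamma (d : ℕ) (hd : 2 ≤ d) (α : ℝ) (hα : 0 < α) (hαd : α < d) :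
    muAlpha d α (ball 0 1) /
        muAlpha d α (ball (EuclideanSpace.single (⟨0, by omega⟩ : Fin d) (1 : ℝ)) 1) =
      ENNReal.ofReal (Real.sqrt Real.pi * Real.Gamma ((2 * d - α) / 2) /
        (2 ^ ((d : ℝ) - α - 1) * Real.Gamma (d / 2) * Real.Gamma (((d : ℝ) - α + 1) / 2))) := by
  have : NeZero d := ⟨by omega⟩
  set s : ℝ := d - α with hs_def
  have hs : 0 < s := sub_pos.2 hαd
  have hd0 : (0 : ℝ) < d := by positivity
  have hball : muAlpha d α (ball 0 1) =
      ENNReal.ofReal (2 * √Real.pi ^ d / Real.Gamma (d / 2) / s) := by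
    rw [muAlpha_eq_lintegral_toSphere hd hαd measurableSet_ball (ρ := fun _ => 1)
      (fun _ => zero_le_one) (fun ω r hr => by
        simp [norm_smul, abs_of_pos hr]), lintegral_const, Measure.toSphere_apply_univ,
      EuclideanSpace.volume_ball, finrank_euclideanSpace_fin, Real.Gamma_add_one (by positivity)]
    have hΓ := Real.Gamma_pos_of_pos (half_pos hd0)
    simp only [← hs_def, Real.one_rpow, ENNReal.ofReal_one, one_pow, one_mul, Fintype.card_fin]
    rw [← ENNReal.ofReal_natCast, ← ENNReal.ofReal_mul (by positivity),
      ← ENNReal.ofReal_mul (by positivity)]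
    congr 1
    field_simp
  have hball' : muAlpha d α (ball (EuclideanSpace.single (⟨0, by omega⟩ : Fin d) (1 : ℝ)) 1) =
      ENNReal.ofReal (2 ^ s / s * (Real.Gamma ((s + 1) / 2) * √Real.pi ^ (d - 1) /
        Real.Gamma ((d + s) / 2))) := by
    rw [muAlpha_eq_lintegral_toSphere hd hαd measurableSet_ball (fun _ => by positivity)
      (fun ω r hr => smul_mem_ball_single_iff _ ω hr), ENNReal.ofReal_mul (by positivity)]
    have h := lintegral_toSphere_max_rpow (⟨0, by omega⟩ : Fin d) hs
    rw [Fintype.card_fin] at h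
    rw [← h, ← lintegral_const_mul _ (by fun_prop)]
    refine lintegral_congr fun ω => ?_
    rw [← ENNReal.ofReal_mul (by positivity), Real.mul_rpow zero_le_two (le_max_right _ _)]
    congr 1
    ring
  have hΓ₁ : 0 < Real.Gamma ((s + 1) / 2) := Real.Gamma_pos_of_pos (by positivity)
  have hΓ₂ : 0 < Real.Gamma ((d + s) / 2) := Real.Gamma_pos_of_pos (by positivity)
  have hΓ₃ : 0 < Real.Gamma ((d : ℝ) / 2) := Real.Gamma_pos_of_pos (by positivity)
  rw [hball, hball', ← ENNReal.ofReal_div_of_pos (by positivity),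
    show (2 * (d : ℝ) - α) / 2 = (d + s) / 2 by rw [hs_def]; ring,
    Real.rpow_sub_one two_ne_zero]
  congr 1
  obtain ⟨n, rfl⟩ : ∃ n, d = n + 1 := ⟨d - 1, by omega⟩
  rw [Nat.add_sub_cancel, pow_succ]
  field_simp
end

section
/- Let d ≥ 1 and 0 < α < d, let μ_α be the measure on ℝ^d with density dμ_α(x) = ‖x‖₂^{-α} dx, and let e₁ be the first standard basis vector. If c ≥ 0 satisfies the weak type (1,1) inequality λ · μ_α({x : M_{μ_α} f(x) > λ}) ≤ c · ‖f‖_{L¹(μ_α)} for all radial f ∈ L¹(μ_α) and all λ > 0, then c ≥ μ_α(B(0,1)) / μ_α(B(e₁,1)). -/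
open MeasureTheory Metric

open Filter
open scoped Topology ENNReal

section MuAlpha

variable {d : ℕ} {α : ℝ}

lemma measurable_ofReal_norm_rpow (d : ℕ) (α : ℝ) :
    Measurable fun x : EuclideanSpace ℝ (Fin d) => ENNReal.ofReal (‖x‖ ^ (-α)) :=
  (measurable_norm.pow_const _).ennreal_ofReal

lemma muAlpha_ball_zero_lt_top (hd : 1 ≤ d) (hαd : α < d) (r : ℝ) :
    muAlpha d α (ball 0 r) < ∞ := by
  have h : IntegrableOn (fun x : EuclideanSpace ℝ (Fin d) => ‖x‖ ^ (-α)) (ball 0 r) volume := by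
    refine integrableOn_ball_of_norm_le_rpow (C := 1) (α := α) (by simpa using hd)
      (by simpa using hαd) (ae_of_all _ fun x => ?_)
      (measurable_norm.pow_const _).aestronglyMeasurable
    rw [one_mul, Real.norm_of_nonneg (by positivity)]
  rw [muAlpha, withDensity_apply _ measurableSet_ball]
  exact h.lintegral_lt_top

lemma muAlpha_closedBall_lt_top (hd : 1 ≤ d) (hαd : α < d) (x : EuclideanSpace ℝ (Fin d))
    (r : ℝ) : muAlpha d α (closedBall x r) < ∞ := by
  refine (measure_mono fun y hy => ?_).trans_lt
    (muAlpha_ball_zero_lt_top hd hαd (r + ‖x‖ + 1))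
  have := dist_triangle y x 0
  rw [mem_closedBall] at hy
  rw [mem_ball]
  rw [dist_zero_right x] at this
  linarith

lemma absolutelyContinuous_muAlpha (hd : 1 ≤ d) :
    (volume : Measure (EuclideanSpace ℝ (Fin d))) ≪ muAlpha d α := by
  have : Nonempty (Fin d) := ⟨⟨0, hd⟩⟩
  refine withDensity_absolutelyContinuous' (measurable_ofReal_norm_rpow d α).aemeasurable ?_
  filter_upwards [Measure.ae_ne volume 0] with x hx
  exact (ENNReal.ofReal_pos.2 (Real.rpow_pos_of_pos (norm_pos_iff.2 hx) _)).ne'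

lemma muAlpha_ball_pos (hd : 1 ≤ d) (x : EuclideanSpace ℝ (Fin d)) {r : ℝ} (hr : 0 < r) :
    0 < muAlpha d α (ball x r) :=
  pos_iff_ne_zero.2 fun h =>
    (measure_ball_pos volume x hr).ne' (absolutelyContinuous_muAlpha hd h)

lemma muAlpha_closedBall_eq_ball (x : EuclideanSpace ℝ (Fin d)) {r : ℝ} (hr : r ≠ 0) :
    muAlpha d α (closedBall x r) = muAlpha d α (ball x r) := by
  have h : muAlpha d α (sphere x r) = 0 :=
    withDensity_absolutelyContinuous _ _ (Measure.addHaar_sphere_of_ne_zero volume x hr)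
  rw [← ball_union_sphere]
  exact le_antisymm ((measure_union_le _ _).trans (by rw [h, add_zero]))
    (measure_mono Set.subset_union_left)

lemma measurePreserving_muAlpha
    (e : EuclideanSpace ℝ (Fin d) ≃ₗᵢ[ℝ] EuclideanSpace ℝ (Fin d)) :
    MeasurePreserving e (muAlpha d α) (muAlpha d α) := by
  refine ⟨e.continuous.measurable, Measure.ext fun s hs => ?_⟩
  rw [Measure.map_apply e.continuous.measurable hs, muAlpha,
    withDensity_apply _ (e.continuous.measurable hs), withDensity_apply _ hs,
    ← e.measurePreserving.setLIntegral_comp_preimage hs (measurable_ofReal_norm_rpow d α)]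
  simp

lemma muAlpha_closedBall_eq_of_norm_eq {u v : EuclideanSpace ℝ (Fin d)} (h : ‖u‖ = ‖v‖) (r : ℝ) :
    muAlpha d α (closedBall u r) = muAlpha d α (closedBall v r) := by
  have hR := Submodule.reflection_sub h
  set R := (Submodule.span ℝ {u - v})ᗮ.reflection
  rw [← (measurePreserving_muAlpha R).measure_preimage (s := closedBall v r)
    measurableSet_closedBall.nullMeasurableSet, R.preimage_closedBall, ← hR, R.symm_apply_apply]

/-- Moving the center of a ball towards the origin while keeping the origin at depth `ε` inside the
ball decreases its measure. -/
lemma muAlpha_closedBall_norm_add_le {u x : EuclideanSpace ℝ (Fin d)} (hu : ‖u‖ = 1)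
    (hx : ‖x‖ < 1) (ε : ℝ) :
    muAlpha d α (closedBall x (‖x‖ + ε)) ≤ muAlpha d α (closedBall u (1 + ε)) := by
  obtain ⟨v, hv, hxv⟩ : ∃ v : EuclideanSpace ℝ (Fin d), ‖v‖ = 1 ∧ x = ‖x‖ • v := by
    rcases eq_or_ne x 0 with rfl | h
    · exact ⟨u, hu, by simp⟩
    · have h' : ‖x‖ ≠ 0 := norm_ne_zero_iff.2 h
      exact ⟨‖x‖⁻¹ • x, by simp [norm_smul, h'], by rw [smul_smul, mul_inv_cancel₀ h', one_smul]⟩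
  rw [muAlpha_closedBall_eq_of_norm_eq (hu.trans hv.symm)]
  refine measure_mono (closedBall_subset_closedBall' ?_)
  have : dist x v = 1 - ‖x‖ := by
    have h : x - v = (‖x‖ - 1) • v := by rw [sub_smul, one_smul, ← hxv]
    rw [dist_eq_norm, h, norm_smul, hv, mul_one, Real.norm_eq_abs, abs_of_nonpos (by linarith)]
    ring
  linarith

lemma isRadial_indicator_ball (ε : ℝ) :
    IsRadial ((ball (0 : EuclideanSpace ℝ (Fin d)) ε).indicator fun _ => (1 : ℝ)) :=
  ⟨fun t => (Set.Iio ε).indicator (fun _ => 1) t, fun x _ => by simp [Set.indicator]⟩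

lemma lintegral_ofReal_abs_indicator_ball (μ : Measure (EuclideanSpace ℝ (Fin d))) (ε : ℝ) :
    ∫⁻ x, ENNReal.ofReal |(ball (0 : EuclideanSpace ℝ (Fin d)) ε).indicator (fun _ => (1 : ℝ)) x| ∂μ
      = μ (ball 0 ε) := by
  rw [← lintegral_indicator_one measurableSet_ball]
  refine lintegral_congr fun x => ?_
  by_cases hx : x ∈ ball (0 : EuclideanSpace ℝ (Fin d)) ε <;> simp [Set.indicator, hx]

lemma div_le_centeredMaximal_indicator_ball (hd : 1 ≤ d)
    {u x : EuclideanSpace ℝ (Fin d)} (hu : ‖u‖ = 1) (hx : ‖x‖ < 1) {ε : ℝ} (hε : 0 < ε) :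
    muAlpha d α (ball 0 ε) / muAlpha d α (closedBall u (1 + ε)) ≤
      centeredMaximal (muAlpha d α) ((ball 0 ε).indicator fun _ => (1 : ℝ)) x := by
  have hr : 0 < ‖x‖ + ε := by positivity
  refine le_trans ?_ (le_iSup_of_le (‖x‖ + ε) (le_iSup_of_le hr (le_iSup_of_le
    ((muAlpha_ball_pos hd x hr).trans_le (measure_mono ball_subset_closedBall)) le_rfl)))
  have hsub : ball (0 : EuclideanSpace ℝ (Fin d)) ε ⊆ closedBall x (‖x‖ + ε) :=
    ball_subset_closedBall.trans
      (closedBall_subset_closedBall' (by rw [dist_zero_left, add_comm]))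
  rw [lintegral_ofReal_abs_indicator_ball, Measure.restrict_apply measurableSet_ball,
    Set.inter_eq_left.2 hsub, ENNReal.div_eq_inv_mul]
  exact mul_le_mul_left (ENNReal.inv_le_inv.2 (muAlpha_closedBall_norm_add_le hu hx ε)) _

end MuAlpha


/-- The discretization lower bound (Proposition 2.1 of [A1]): any weak type `(1,1)` constant `c`
for the centered maximal operator associated to `dμ_α(x) = ‖x‖₂^{-α} dx`, acting on radial
functions, satisfies `c ≥ μ_α(B(0,1))/μ_α(B(e₁,1))`. -/
theorem weak_constant_ge_shifted_ball_ratio (d : ℕ) (hd : 1 ≤ d)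
    (α : ℝ) (hα : 0 < α) (hαd : α < d) (c : ℝ) (hc : 0 ≤ c)
    (hweak : ∀ f : EuclideanSpace ℝ (Fin d) → ℝ, IsRadial f →
      Integrable f (muAlpha d α) → ∀ lam : ℝ, 0 < lam →
        ENNReal.ofReal lam *
            (muAlpha d α) {x | ENNReal.ofReal lam < centeredMaximal (muAlpha d α) f x} ≤
          ENNReal.ofReal c * ∫⁻ x, ENNReal.ofReal |f x| ∂(muAlpha d α)) :
    muAlpha d α (ball 0 1) /
        muAlpha d α (ball (EuclideanSpace.single (⟨0, by omega⟩ : Fin d) (1 : ℝ)) 1) ≤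
      ENNReal.ofReal c := by
  set μ := muAlpha d α with hμ
  set e : EuclideanSpace ℝ (Fin d) := EuclideanSpace.single (⟨0, by omega⟩ : Fin d) (1 : ℝ)
  have he : ‖e‖ = 1 := by simp [e]
  have hB0 : μ (ball 0 1) ≠ 0 := (muAlpha_ball_pos hd 0 one_pos).ne'
  have hBtop : μ (ball 0 1) ≠ ∞ := (muAlpha_ball_zero_lt_top hd hαd 1).ne
  have key : ∀ ε : ℝ, 0 < ε → μ (ball 0 1) ≤ ENNReal.ofReal c * μ (closedBall e (1 + ε)) := by
    intro ε hε
    have hm0 : μ (ball 0 ε) ≠ 0 := (muAlpha_ball_pos hd 0 hε).ne'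
    have hmtop : μ (ball 0 ε) ≠ ∞ := (muAlpha_ball_zero_lt_top hd hαd ε).ne
    have hK0 : μ (closedBall e (1 + ε)) ≠ 0 :=
      ((muAlpha_ball_pos hd e (by positivity)).trans_le (measure_mono ball_subset_closedBall)).ne'
    have hKtop : μ (closedBall e (1 + ε)) ≠ ∞ := (muAlpha_closedBall_lt_top hd hαd e _).ne
    have hint : Integrable ((ball 0 ε).indicator fun _ => (1 : ℝ)) μ :=
      (integrable_indicator_iff measurableSet_ball).2 (integrableOn_const hmtop)
    have hle : μ (ball 0 ε) / μ (closedBall e (1 + ε)) ≤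
        ENNReal.ofReal c * μ (ball 0 ε) / μ (ball 0 1) := by
      refine ENNReal.le_of_forall_nnreal_lt fun r hr => ?_
      rcases eq_or_ne r 0 with rfl | hr0
      · simp
      rw [ENNReal.le_div_iff_mul_le (Or.inl hB0) (Or.inl hBtop)]
      have h := hweak _ (isRadial_indicator_ball ε) hint r (NNReal.coe_pos.2 (pos_iff_ne_zero.2 hr0))
      rw [lintegral_ofReal_abs_indicator_ball, ENNReal.ofReal_coe_nnreal] at h
      refine le_trans ?_ h
      gcongr
      exact fun x hx => hr.trans_le
        (div_le_centeredMaximal_indicator_ball hd he (by simpa using hx) hε)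
    rw [ENNReal.le_div_iff_mul_le (Or.inl hB0) (Or.inl hBtop), ENNReal.div_eq_inv_mul, mul_assoc,
      ENNReal.inv_mul_le_iff hK0 hKtop, mul_comm, ← mul_assoc] at hle
    rw [mul_comm (ENNReal.ofReal c)]
    exact (ENNReal.mul_le_mul_iff_left hm0 hmtop).1 hle
  have hlim : Tendsto (fun ε : ℝ => μ (closedBall e (1 + ε))) (𝓝[>] 0) (𝓝 (μ (ball e 1))) := by
    rw [← muAlpha_closedBall_eq_ball e one_ne_zero]
    have h := tendsto_measure_cthickening_of_isClosed (μ := μ) (s := closedBall e 1)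
      ⟨1, one_pos, by
        rw [cthickening_closedBall zero_le_one zero_le_one]
        exact (muAlpha_closedBall_lt_top hd hαd e _).ne⟩ isClosed_closedBall
    refine (h.mono_left nhdsWithin_le_nhds).congr' ?_
    filter_upwards [self_mem_nhdsWithin] with ε hε
    rw [cthickening_closedBall (le_of_lt hε) zero_le_one, add_comm]
  refine ENNReal.div_le_of_le_mul (ge_of_tendsto
    (ENNReal.Tendsto.const_mul hlim (Or.inr ENNReal.ofReal_ne_top)) ?_)
  filter_upwards [self_mem_nhdsWithin] with ε hε using key ε hε
end

section
/- Let μ be an arbitrary Borel measure on ℝ (nonnegative, countably additive, not identically zero, possibly assigning infinite measure to some intervals), let f ∈ L¹(μ), and let M^u_μ be the uncentered Hardy–Littlewood maximal operator with respect to μ. Then for every λ > 0, λ · μ({x : M^u_μ f(x) > λ}) ≤ 2 · ‖f‖_{L¹(μ)}. -/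
open MeasureTheory

/-- The uncentered Hardy–Littlewood maximal operator on `ℝ` with respect to a Borel measure `ν`:
the supremum of the averages of `|f|` over all bounded open intervals containing `x` and of
positive measure. -/
noncomputable def uncenteredMaximal (ν : Measure ℝ) (f : ℝ → ℝ) (x : ℝ) : ENNReal :=
  ⨆ (a : ℝ) (b : ℝ) (_ : x ∈ Set.Ioo a b) (_ : 0 < ν (Set.Ioo a b)),
    (ν (Set.Ioo a b))⁻¹ * ∫⁻ y in Set.Ioo a b, ENNReal.ofReal |f y| ∂ν

/-- Finitely many open intervals of a linear order can be thinned out, without changing their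
union, so that no point lies in more than two of the remaining ones. -/
theorem exists_subset_biUnion_Ioo_eq_card_le_two {α : Type*} [LinearOrder α]
    (F : Finset (α × α)) :
    ∃ G ⊆ F, (⋃ p ∈ G, Set.Ioo p.1 p.2) = (⋃ p ∈ F, Set.Ioo p.1 p.2) ∧
      ∀ x, (G.filter fun p => x ∈ Set.Ioo p.1 p.2).card ≤ 2 := by
  induction F using Finset.strongInduction with
  | H F ih =>
    by_cases h : ∀ x, (F.filter fun p => x ∈ Set.Ioo p.1 p.2).card ≤ 2
    · exact ⟨F, subset_rfl, rfl, h⟩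
    push Not at h
    obtain ⟨x, hx⟩ := h
    set H := F.filter fun p => x ∈ Set.Ioo p.1 p.2 with hH
    have hne : H.Nonempty := Finset.card_pos.1 (by omega)
    obtain ⟨p, hp, hpmin⟩ := H.exists_min_image Prod.fst hne
    obtain ⟨q, hq, hqmax⟩ := H.exists_max_image Prod.snd hne
    obtain ⟨r, hr, hrpq⟩ := Finset.exists_mem_notMem_of_card_lt_card
      ((Finset.card_le_two (a := p) (b := q)).trans_lt hx)
    simp only [Finset.mem_insert, Finset.mem_singleton, not_or] at hrpq
    have hpr := hpmin r hr
    have hqr := hqmax r hr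
    simp only [hH, Finset.mem_filter, Set.mem_Ioo] at hp hq hr
    obtain ⟨G, hGF, hGU, hG⟩ := ih _ (Finset.erase_ssubset hr.1)
    refine ⟨G, hGF.trans (Finset.erase_subset _ _), hGU.trans ?_, hG⟩
    apply subset_antisymm
    · exact Set.biUnion_subset_biUnion_left (Finset.erase_subset r F)
    · refine Set.iUnion₂_subset fun s hs y hy => ?_
      rw [Set.mem_iUnion₂]
      by_cases hsr : s = r
      · subst hsr
        rcases le_total y x with hyx | hxy
        · exact ⟨p, Finset.mem_erase.2 ⟨Ne.symm hrpq.1, hp.1⟩,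
            hpr.trans_lt hy.1, hyx.trans_lt hp.2.2⟩
        · exact ⟨q, Finset.mem_erase.2 ⟨Ne.symm hrpq.2, hq.1⟩,
            hq.2.1.trans_le hxy, hy.2.trans_le hqr⟩
      · exact ⟨s, Finset.mem_erase.2 ⟨hsr, hs⟩, hy⟩

/-- A family of measurable sets covering each point at most `n` times has total integral at most
`n` times the full integral. -/
theorem sum_setLIntegral_le_of_card_le {α ι : Type*} [MeasurableSpace α] (μ : Measure α)
    (G : Finset ι) (s : ι → Set α) (hs : ∀ i ∈ G, MeasurableSet (s i)) (n : ℕ)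
    [∀ x, DecidablePred fun i => x ∈ s i]
    (hG : ∀ x, (G.filter fun i => x ∈ s i).card ≤ n) {g : α → ENNReal} (hg : AEMeasurable g μ) :
    ∑ i ∈ G, ∫⁻ x in s i, g x ∂μ ≤ n * ∫⁻ x, g x ∂μ := by
  classical
  calc ∑ i ∈ G, ∫⁻ x in s i, g x ∂μ
      = ∑ i ∈ G, ∫⁻ x, (s i).indicator g x ∂μ :=
        Finset.sum_congr rfl fun i hi => (lintegral_indicator (hs i hi) g).symm
    _ = ∫⁻ x, ∑ i ∈ G, (s i).indicator g x ∂μ :=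
        (lintegral_finsetSum' G fun i hi => hg.indicator (hs i hi)).symm
    _ ≤ ∫⁻ x, n * g x ∂μ := by
        refine lintegral_mono fun x => ?_
        simp only [Set.indicator_apply]
        rw [← Finset.sum_filter, Finset.sum_const, nsmul_eq_mul]
        gcongr
        convert hG x
    _ = n * ∫⁻ x, g x ∂μ := lintegral_const_mul' _ _ (ENNReal.natCast_ne_top n)

/-- If `c * μ I ≤ ∫⁻ x in I, g x ∂μ` for every interval `I` of a family of open intervals, then
`c * μ U ≤ 2 * ∫⁻ x, g x ∂μ` for the union `U` of the family. -/
theorem mul_measure_biUnion_Ioo_le (μ : Measure ℝ) {g : ℝ → ENNReal} (hg : AEMeasurable g μ)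
    (c : ENNReal) (S : Set (ℝ × ℝ))
    (hS : ∀ p ∈ S, c * μ (Set.Ioo p.1 p.2) ≤ ∫⁻ x in Set.Ioo p.1 p.2, g x ∂μ) :
    c * μ (⋃ p ∈ S, Set.Ioo p.1 p.2) ≤ 2 * ∫⁻ x, g x ∂μ := by
  classical
  obtain ⟨T, hTS, hT, hTU⟩ := TopologicalSpace.isOpen_biUnion_countable S
    (fun p : ℝ × ℝ => Set.Ioo p.1 p.2) fun _ _ => isOpen_Ioo
  have := hT.to_subtype
  have hmono : Monotone fun F : Finset T => ⋃ p ∈ F, Set.Ioo p.1.1 p.1.2 :=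
    fun _ _ h => Set.biUnion_subset_biUnion_left h
  rw [← hTU, Set.biUnion_eq_iUnion, Set.iUnion_eq_iUnion_finset,
    hmono.directed_le.measure_iUnion, ENNReal.mul_iSup]
  refine iSup_le fun F => ?_
  obtain ⟨G, hGF, hGU, hG⟩ :=
    exists_subset_biUnion_Ioo_eq_card_le_two (F.map (Function.Embedding.subtype _))
  have hU : (⋃ p ∈ F, Set.Ioo p.1.1 p.1.2) = ⋃ p ∈ G, Set.Ioo p.1 p.2 := by
    rw [hGU]
    ext
    simp
  have hGS : ∀ p ∈ G, p ∈ S := fun p hp => by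
    obtain ⟨q, -, rfl⟩ := Finset.mem_map.1 (hGF hp)
    exact hTS q.2
  calc c * μ (⋃ p ∈ F, Set.Ioo p.1.1 p.1.2)
      ≤ c * ∑ p ∈ G, μ (Set.Ioo p.1 p.2) := by
        rw [hU]
        gcongr
        exact measure_biUnion_finset_le _ _
    _ ≤ ∑ p ∈ G, ∫⁻ x in Set.Ioo p.1 p.2, g x ∂μ := by
        rw [Finset.mul_sum]
        exact Finset.sum_le_sum fun p hp => hS p (hGS p hp)
    _ ≤ 2 * ∫⁻ x, g x ∂μ := by
        simpa using sum_setLIntegral_le_of_card_le μ G (fun p => Set.Ioo p.1 p.2)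
          (fun _ _ => measurableSet_Ioo) 2 (fun x => by convert hG x) hg

/-- For an arbitrary (nonzero) Borel measure `μ` on `ℝ`, the uncentered Hardy–Littlewood maximal
operator satisfies the weak type `(1,1)` inequality with constant `2`. -/
theorem uncentered_weak_one_one (μ : Measure ℝ) (hμ : μ ≠ 0)
    (f : ℝ → ℝ) (hf : Integrable f μ) (lam : ℝ) (hlam : 0 < lam) :
    ENNReal.ofReal lam * μ {x | ENNReal.ofReal lam < uncenteredMaximal μ f x} ≤
      2 * ∫⁻ x, ENNReal.ofReal |f x| ∂μ := by
  have hg : AEMeasurable (fun x => ENNReal.ofReal |f x|) μ :=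
    hf.aestronglyMeasurable.aemeasurable.abs.ennreal_ofReal
  refine le_trans ?_ (mul_measure_biUnion_Ioo_le μ hg (ENNReal.ofReal lam)
    {p | ENNReal.ofReal lam * μ (Set.Ioo p.1 p.2) ≤
      ∫⁻ x in Set.Ioo p.1 p.2, ENNReal.ofReal |f x| ∂μ} fun _ hp => hp)
  gcongr
  intro x hx
  simp only [Set.mem_ofPred_eq, uncenteredMaximal, lt_iSup_iff] at hx
  obtain ⟨a, b, hxab, -, h⟩ := hx
  refine Set.mem_iUnion₂.2 ⟨(a, b), ?_, hxab⟩
  rw [mul_comm, ← div_eq_mul_inv] at h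
  exact ENNReal.mul_le_of_le_div h.le
end

section
/- Given any finite family I₁, …, I_n of open intervals of ℝ, there exist two sets of indices S, T ⊆ {1, …, n} such that the subfamily {I_i : i ∈ S} is pairwise disjoint, the subfamily {I_i : i ∈ T} is pairwise disjoint, and the union of the intervals indexed by S ∪ T equals the union I₁ ∪ ⋯ ∪ I_n of the whole family. -/
open Set

/-- A subfamily of a finite family of sets that is minimal among those with the same union has a
private point in each of its members. -/
theorem exists_subfamily_iUnion_eq_private_points {ι α : Type*} [Fintype ι] (s : ι → Set α) :
    ∃ M : Finset ι, (⋃ i ∈ M, s i) = ⋃ i, s i ∧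
      ∀ i ∈ M, ∃ x ∈ s i, ∀ j ∈ M, j ≠ i → x ∉ s j := by
  classical
  obtain ⟨M, hM, hmin⟩ := exists_minimal_of_wellFoundedLT
    (fun M : Finset ι => (⋃ i ∈ M, s i) = ⋃ i, s i) ⟨Finset.univ, by simp⟩
  refine ⟨M, hM, fun i hi => ?_⟩
  by_contra! h
  refine Finset.notMem_erase i M (hmin (y := M.erase i) ?_ (Finset.erase_subset i M) hi)
  refine Subset.antisymm (iUnion₂_subset fun j _ => subset_iUnion s j) ?_
  rw [← hM]
  refine iUnion₂_subset fun j hj x hx => ?_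
  by_cases hji : j = i
  · obtain ⟨k, hk, hki, hxk⟩ := h x (hji ▸ hx)
    exact mem_iUnion₂_of_mem (Finset.mem_erase.2 ⟨hki, hk⟩) hxk
  · exact mem_iUnion₂_of_mem (Finset.mem_erase.2 ⟨hji, hj⟩) hx

/-- Two order-connected sets containing points on either side of `y`, but not `y` itself, are
disjoint. -/
theorem Set.OrdConnected.disjoint_of_lt_of_lt {α : Type*} [LinearOrder α] {s t : Set α}
    (hs : s.OrdConnected) (ht : t.OrdConnected) {x y z : α} (hx : x ∈ s) (hz : z ∈ t)
    (hxy : x < y) (hyz : y < z) (hys : y ∉ s) (hyt : y ∉ t) : Disjoint s t := by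
  refine Set.disjoint_left.2 fun w hws hwt => ?_
  rcases le_total w y with h | h
  · exact hyt (ht.out hwt hz ⟨h, hyz.le⟩)
  · exact hys (hs.out hx hws ⟨hxy.le, h⟩)

/-- If the ranks of two elements of a finite set with respect to `p` have the same parity, some
element of the set lies strictly between them. -/
theorem Finset.exists_between_of_card_filter_lt_mod_two_eq {ι α : Type*} [LinearOrder α]
    {M : Finset ι} {p : ι → α} (hp : Set.InjOn p M) {i k : ι} (hi : i ∈ M) (hik : p i < p k)
    (h : (M.filter fun j => p j < p i).card % 2 = (M.filter fun j => p j < p k).card % 2) :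
    ∃ j ∈ M, p i < p j ∧ p j < p k := by
  classical
  by_contra! hbetween
  have hins : (M.filter fun j => p j < p k) = insert i (M.filter fun j => p j < p i) := by
    ext j
    simp only [Finset.mem_filter, Finset.mem_insert]
    constructor
    · rintro ⟨hj, hjk⟩
      rcases lt_trichotomy (p j) (p i) with hlt | heq | hgt
      · exact Or.inr ⟨hj, hlt⟩
      · exact Or.inl (hp hj hi heq)
      · exact absurd hjk (hbetween j hj hgt).not_gt
    · rintro (rfl | ⟨hj, hji⟩)
      · exact ⟨hi, hik⟩
      · exact ⟨hj, hji.trans hik⟩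
  rw [hins, Finset.card_insert_of_notMem (by simp)] at h
  omega

/-- From any finite family of order-connected sets in a linear order one can extract two pairwise
disjoint subfamilies whose union is the union of the whole family. -/
theorem exists_two_pairwiseDisjoint_iUnion_eq_of_ordConnected {ι α : Type*} [Fintype ι]
    [DecidableEq ι] [LinearOrder α] (s : ι → Set α) (hs : ∀ i, (s i).OrdConnected) :
    ∃ S T : Finset ι, (S : Set ι).PairwiseDisjoint s ∧ (T : Set ι).PairwiseDisjoint s ∧
      (⋃ i ∈ S ∪ T, s i) = ⋃ i, s i := by
  obtain ⟨M, hM, hpriv⟩ := exists_subfamily_iUnion_eq_private_points s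
  rcases M.eq_empty_or_nonempty with rfl | ⟨i₀, hi₀⟩
  · exact ⟨∅, ∅, by simp, by simp, by simpa using hM⟩
  have : Nonempty α := (hpriv i₀ hi₀).nonempty
  choose! p hps hp using hpriv
  have hinj : Set.InjOn p M := fun i hi j hj hij => by
    by_contra hne
    exact hp i hi j hj (Ne.symm hne) (hij ▸ hps j hj)
  let rank (i : ι) : ℕ := (M.filter fun j => p j < p i).card
  have hdisj {i k : ι} (hi : i ∈ M) (hk : k ∈ M) (hik : p i < p k)
      (h : rank i % 2 = rank k % 2) : Disjoint (s i) (s k) := by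
    obtain ⟨j, hj, hij, hjk⟩ := Finset.exists_between_of_card_filter_lt_mod_two_eq hinj hi hik h
    exact (hs i).disjoint_of_lt_of_lt (hs k) (hps i hi) (hps k hk) hij hjk
      (hp j hj i hi fun e => hij.ne (congrArg p e))
      (hp j hj k hk fun e => hjk.ne' (congrArg p e))
  have hclass (r : ℕ) : ((M.filter fun i => rank i % 2 = r : Finset ι) : Set ι).PairwiseDisjoint
      s := by
    intro i hi k hk hne
    obtain ⟨hi, hri⟩ := Finset.mem_filter.1 hi
    obtain ⟨hk, hrk⟩ := Finset.mem_filter.1 hk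
    rcases lt_or_gt_of_ne (hinj.ne hi hk hne) with hlt | hgt
    · exact hdisj hi hk hlt (hri.trans hrk.symm)
    · exact (hdisj hk hi hgt (hrk.trans hri.symm)).symm
  refine ⟨_, _, hclass 0, hclass 1, ?_⟩
  rw [← Finset.filter_or, Finset.filter_true_of_mem fun i _ => Nat.mod_two_eq_zero_or_one _, hM]

/-- From any finite family of open intervals of `ℝ` one can extract two pairwise disjoint
subfamilies whose union is the union of the whole family. -/
theorem two_disjoint_subfamilies_cover (n : ℕ) (a b : Fin n → ℝ) :
    ∃ S T : Finset (Fin n),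
      ((S : Set (Fin n)).PairwiseDisjoint fun i => Ioo (a i) (b i)) ∧
      ((T : Set (Fin n)).PairwiseDisjoint fun i => Ioo (a i) (b i)) ∧
      (⋃ i ∈ (S ∪ T : Finset (Fin n)), Ioo (a i) (b i)) = ⋃ i, Ioo (a i) (b i) :=
  exists_two_pairwiseDisjoint_iUnion_eq_of_ordConnected _ fun _ => ordConnected_Ioo
end
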